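/- Under the standing hypotheses, no vertex of G lies in three pairwise distinct g-cycles of G. -/

import Mathlib

open SimpleGraph

/-- Two graphs have the same `k`-deck if there is a bijection between their `k`-element
vertex subsets under which corresponding induced subgraphs are isomorphic. -/
def SameDeck {V W : Type*} [Fintype V] [Fintype W] [DecidableEq V] [DecidableEq W]
    (G : SimpleGraph V) (H : SimpleGraph W) (k : ℕ) : Prop :=
  ∃ e : {s : Finset V // s.card = k} ≃ {s : Finset W // s.card = k},
    ∀ s : {s : Finset V // s.card = k},
      Nonempty ((G.induce (↑s.1 : Set V)) ≃g (H.induce (↑(e s).1 : Set W)))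

/-- Every vertex of `s` has at least two neighbours in `s`. -/
def MinTwo {V : Type*} (K : SimpleGraph V) (s : Finset V) : Prop :=
  ∀ v ∈ s, ∃ u ∈ s, ∃ w ∈ s, u ≠ w ∧ K.Adj v u ∧ K.Adj v w

/-- Every nonempty vertex set spanning minimum degree at least two has at least `g` elements. -/
def LargeGirth {V : Type*} (K : SimpleGraph V) (g : ℕ) : Prop :=
  ∀ s : Finset V, s.Nonempty → MinTwo K s → g ≤ s.card

/-- `s` has `g` elements and spans minimum degree at least two: in a graph of girth `g`, the
vertex sets of the `g`-cycles. -/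
def IsGCycle {V : Type*} (K : SimpleGraph V) (g : ℕ) (s : Finset V) : Prop :=
  s.card = g ∧ MinTwo K s

section Walks

variable {V : Type*} {K : SimpleGraph V} {g : ℕ}

lemma exists_isCycle_of_forall_two_neighbors [Finite V] [Nonempty V]
    (h : ∀ v, ∃ u w, u ≠ w ∧ K.Adj v u ∧ K.Adj v w) :
    ∃ (v : V) (c : K.Walk v v), c.IsCycle := by
  have := Fintype.ofFinite V
  by_contra hc
  have hK : K.IsAcyclic := fun v c hv => hc ⟨v, c, hv⟩
  have key : ∀ n : ℕ, ∃ (u v : V) (p : K.Walk u v), p.IsPath ∧ p.length = n := by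
    intro n
    induction n with
    | zero => exact ⟨Classical.arbitrary V, _, Walk.nil, by simp⟩
    | succ n ih =>
      obtain ⟨u, v, p, hp, hn⟩ := ih
      obtain ⟨a, b, hab, ha, hb⟩ := h v
      obtain ⟨w, hw, hwp⟩ : ∃ w, K.Adj v w ∧ w ∉ p.support := by
        by_contra! hcon
        exact hab ((hK.eq_penultimate_of_adj_end hp ha (hcon a ha)).trans
          (hK.eq_penultimate_of_adj_end hp hb (hcon b hb)).symm)
      exact ⟨u, w, p.concat hw, hp.concat hwp hw, by simp [hn]⟩
  obtain ⟨u, v, p, hp, hn⟩ := key (Fintype.card V)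
  exact absurd hp.length_lt (by omega)

lemma MinTwo.exists_isCycle {s : Finset V} (hs : s.Nonempty) (h : MinTwo K s) :
    ∃ (v : V) (c : K.Walk v v), c.IsCycle ∧ ∀ w ∈ c.support, w ∈ s := by
  have : Nonempty (s : Set V) := hs.to_subtype
  obtain ⟨v, c, hc⟩ := exists_isCycle_of_forall_two_neighbors (K := K.induce (s : Set V)) (by
    rintro ⟨v, hv⟩
    obtain ⟨u, hu, w, hw, huw, h1, h2⟩ := h v hv
    exact ⟨⟨u, hu⟩, ⟨w, hw⟩, by simpa using huw, h1, h2⟩)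
  refine ⟨_, c.map (Embedding.induce (G := K) (s : Set V)).toHom,
    hc.map (Embedding.induce (G := K) (s : Set V)).injective, ?_⟩
  intro w hw
  rw [Walk.support_map, List.mem_map] at hw
  obtain ⟨x, -, rfl⟩ := hw
  exact x.2

lemma SimpleGraph.Walk.IsCycle.exists_two_edges {v w : V} {c : K.Walk v v} (hc : c.IsCycle)
    (hw : w ∈ c.support) :
    ∃ u ∈ c.support, ∃ u' ∈ c.support, u ≠ u' ∧ s(w, u) ∈ c.edges ∧ s(w, u') ∈ c.edges := by
  obtain ⟨u, u', huu, h⟩ := Set.ncard_eq_two.mp (hc.ncard_neighborSet_toSubgraph_eq_two hw)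
  have h1 : c.toSubgraph.Adj w u := by
    rw [← Subgraph.mem_neighborSet, h]; simp
  have h2 : c.toSubgraph.Adj w u' := by
    rw [← Subgraph.mem_neighborSet, h]; simp
  rw [← Subgraph.mem_edgeSet, Walk.mem_edges_toSubgraph] at h1 h2
  exact ⟨u, c.snd_mem_support_of_mem_edges h1, u', c.snd_mem_support_of_mem_edges h2, huu, h1, h2⟩

variable [DecidableEq V]

lemma SimpleGraph.Walk.IsCycle.card_support_toFinset {v : V} {c : K.Walk v v} (hc : c.IsCycle) :
    c.support.toFinset.card = c.length := by
  have h : c.support.toFinset = c.support.tail.toFinset := by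
    ext w
    simp only [List.mem_toFinset]
    refine ⟨fun hw => ?_, List.mem_of_mem_tail⟩
    rcases (Walk.mem_support_iff c).mp hw with rfl | hw
    · exact c.end_mem_tail_support hc.not_nil
    · exact hw
  rw [h, List.toFinset_card_of_nodup hc.support_nodup]
  simp

lemma SimpleGraph.Walk.IsCycle.minTwo_support {v : V} {c : K.Walk v v} (hc : c.IsCycle) :
    MinTwo K c.support.toFinset := by
  intro w hw
  obtain ⟨u, hu, u', hu', hne, h1, h2⟩ := hc.exists_two_edges (List.mem_toFinset.mp hw)
  exact ⟨u, List.mem_toFinset.mpr hu, u', List.mem_toFinset.mpr hu', hne,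
    c.adj_of_mem_edges h1, c.adj_of_mem_edges h2⟩

lemma LargeGirth.le_length (hK : LargeGirth K g) {v : V} {c : K.Walk v v} (hc : c.IsCycle) :
    g ≤ c.length := by
  rw [← hc.card_support_toFinset]
  exact hK _ ⟨v, by simp⟩ hc.minTwo_support

/-- A path of length at least two with adjacent ends closes up to a cycle. -/
lemma LargeGirth.le_length_add_one (hK : LargeGirth K g) {u v : V} {p : K.Walk u v}
    (hp : p.IsPath) (h : K.Adj v u) (hsnd : p.snd ≠ v) : g ≤ p.length + 1 := by
  have hc : (Walk.cons h p).IsCycle := by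
    rw [Walk.cons_isCycle_iff]
    refine ⟨hp, fun hmem => hsnd (hp.snd_of_toSubgraph_adj ?_)⟩
    rw [← Subgraph.mem_edgeSet, Walk.mem_edges_toSubgraph, Sym2.eq_swap]
    exact hmem
  simpa using hK.le_length hc

lemma LargeGirth.le_length_add_two (hK : LargeGirth K g) {u v x : V} {p : K.Walk u v}
    (hp : p.IsPath) (huv : u ≠ v) (hx : x ∉ p.support) (hu : K.Adj x u) (hv : K.Adj v x) :
    g ≤ p.length + 2 := by
  have := hK.le_length_add_one (hp.concat hx hv) hu (by
    intro h
    have h2 : (p.concat hv).snd = p.snd := by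
      cases p with
      | nil => exact absurd rfl huv
      | cons h' q => simp [Walk.concat_cons]
    rw [h2] at h
    exact hx (h ▸ p.getVert_mem_support 1))
  simpa using this

lemma IsGCycle.exists_walk (hK : LargeGirth K g) {s : Finset V} (h : IsGCycle K g s) {v : V}
    (hv : v ∈ s) : ∃ c : K.Walk v v, c.IsCycle ∧ c.length = g ∧ ∀ w, w ∈ c.support ↔ w ∈ s := by
  obtain ⟨v', c, hc, hcs⟩ := h.2.exists_isCycle ⟨v, hv⟩
  have hsub : c.support.toFinset ⊆ s := fun w hw => hcs w (List.mem_toFinset.mp hw)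
  have heq : c.support.toFinset = s := Finset.eq_of_subset_of_card_le hsub (by
    rw [hc.card_support_toFinset, h.1]
    exact hK.le_length hc)
  have hv' : v ∈ c.support := by rwa [← List.mem_toFinset, heq]
  refine ⟨c.rotate v hv', hc.rotate hv', ?_, ?_⟩
  · rw [Walk.length_rotate, ← hc.card_support_toFinset, heq, h.1]
  · intro w
    rw [← heq, Walk.mem_support_rotate_iff, List.mem_toFinset]

/-- In a graph of girth `g`, a `g`-cycle has no chord. -/
lemma IsGCycle.two_neighbors (hK : LargeGirth K g) {s : Finset V} (h : IsGCycle K g s) {v : V}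
    (hv : v ∈ s) : ∃ u ∈ s, ∃ w ∈ s, u ≠ w ∧ ∀ t ∈ s, K.Adj v t ↔ t = u ∨ t = w := by
  obtain ⟨c, hc, hlen, hsupp⟩ := h.exists_walk hK hv
  refine ⟨c.snd, (hsupp _).mp (c.getVert_mem_support _), c.penultimate,
    (hsupp _).mp (c.getVert_mem_support _), hc.snd_ne_penultimate, fun t ht => ⟨fun hvt => ?_, ?_⟩⟩
  · by_contra! hcon
    have htc := (hsupp t).mpr ht
    have hlt := Walk.length_takeUntil_lt_length htc hvt.ne'
    have hget := c.getVert_length_takeUntil htc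
    have hne : (c.takeUntil t htc).length ≠ c.length - 1 := fun he => by
      rw [he] at hget
      exact hcon.2 hget.symm
    have := hK.le_length_add_one (hc.isPath_takeUntil htc) hvt.symm (by
      rw [Walk.snd_takeUntil hvt.ne']
      exact hcon.1.symm)
    omega
  · rintro (rfl | rfl)
    · exact c.adj_snd hc.not_nil
    · exact (c.adj_penultimate hc.not_nil).symm

/-- In a graph of girth `g ≥ 5`, a vertex off a `g`-cycle has at most one neighbour on it. -/
lemma IsGCycle.eq_of_adj (hg : 5 ≤ g) (hK : LargeGirth K g) {s : Finset V} (h : IsGCycle K g s)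
    {x u v : V} (hx : x ∉ s) (hu : u ∈ s) (hv : v ∈ s) (hxu : K.Adj x u) (hxv : K.Adj x v) :
    u = v := by
  by_contra huv
  obtain ⟨c, hc, hlen, hsupp⟩ := h.exists_walk hK hu
  have hvc := (hsupp v).mpr hv
  have hxc : x ∉ c.support := fun hh => hx ((hsupp x).mp hh)
  have h1 := hK.le_length_add_two (hc.isPath_takeUntil hvc) huv
    (fun hh => hxc (c.support_takeUntil_subset_support hvc hh)) hxu hxv.symm
  have h2 := hK.le_length_add_two (p := c.dropUntil v hvc) (by
      rw [← c.take_spec hvc] at hc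
      exact hc.isPath_of_append_right (Walk.not_nil_of_ne huv)) (Ne.symm huv)
    (fun hh => hxc (c.support_dropUntil_subset_support hvc hh)) hxv hxu.symm
  have h3 := congrArg Walk.length (c.take_spec hvc)
  rw [Walk.length_append] at h3
  omega

end Walks

/-- The neighbours of `v` are the three distinct vertices `a`, `b` and `c`. -/
def Nbrs {V : Type*} (K : SimpleGraph V) (v a b c : V) : Prop :=
  a ≠ b ∧ a ≠ c ∧ b ≠ c ∧ ∀ t, K.Adj v t ↔ t = a ∨ t = b ∨ t = c

/-- `K` and `K'` have the same edges between vertices other than `x` and `y`. -/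
def AgreeOff {V : Type*} (K K' : SimpleGraph V) (x y : V) : Prop :=
  ∀ u v, u ≠ x → u ≠ y → v ≠ x → v ≠ y → (K.Adj u v ↔ K'.Adj u v)

/-- Within `P`, every vertex other than `u` and `v` has two neighbours and `u` and `v` have at
least one. -/
def PathSet {V : Type*} (K : SimpleGraph V) (P : Finset V) (u v : V) : Prop :=
  u ∈ P ∧ v ∈ P ∧ u ≠ v ∧ (∃ t ∈ P, K.Adj u t) ∧ (∃ t ∈ P, K.Adj v t) ∧
    ∀ t ∈ P, t ≠ u → t ≠ v → ∃ p ∈ P, ∃ q ∈ P, p ≠ q ∧ K.Adj t p ∧ K.Adj t q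

/-- A class of cubic graphs on `V`, closed under isomorphism, in which any graph can be changed to
a non-isomorphic one by altering only edges at two given vertices. -/
structure FlipClass {V : Type*} (Good : SimpleGraph V → Prop) : Prop where
  nbrs : ∀ {K}, Good K → ∀ v, ∃ a b c, Nbrs K v a b c
  iso : ∀ {K K'}, Good K → Nonempty (K ≃g K') → Good K'
  flip : ∀ {K}, Good K → ∀ {x y}, x ≠ y →
    ∃ K', Good K' ∧ IsEmpty (K ≃g K') ∧ AgreeOff K K' x y

section Basic

variable {V : Type*} {K K' : SimpleGraph V} {v x y a b c : V}

lemma Nbrs.swap₁₂ (h : Nbrs K v a b c) : Nbrs K v b a c := by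
  unfold Nbrs at *; grind

lemma Nbrs.swap₂₃ (h : Nbrs K v a b c) : Nbrs K v a c b := by
  unfold Nbrs at *; grind

lemma Nbrs.swap₁₃ (h : Nbrs K v a b c) : Nbrs K v c b a := by
  unfold Nbrs at *; grind

lemma Nbrs.adj₁ (h : Nbrs K v a b c) : K.Adj v a := (h.2.2.2 a).2 (by simp)

lemma Nbrs.adj₂ (h : Nbrs K v a b c) : K.Adj v b := (h.2.2.2 b).2 (by simp)

lemma Nbrs.adj₃ (h : Nbrs K v a b c) : K.Adj v c := (h.2.2.2 c).2 (by simp)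

lemma Nbrs.exists_of_adj (h : Nbrs K v a b c) (hx : K.Adj v x) : ∃ p q, Nbrs K v x p q := by
  rcases (h.2.2.2 x).1 hx with rfl | rfl | rfl
  exacts [⟨_, _, h⟩, ⟨_, _, h.swap₁₂⟩, ⟨_, _, h.swap₁₃⟩]

lemma Nbrs.exists_of_adj_of_adj (h : Nbrs K v a b c) (hx : K.Adj v x) (hy : K.Adj v y)
    (hxy : x ≠ y) : ∃ q, Nbrs K v x y q := by
  obtain ⟨p, q, h'⟩ := h.exists_of_adj hx
  rcases (h'.2.2.2 y).1 hy with rfl | rfl | rfl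
  exacts [absurd rfl hxy, ⟨_, h'⟩, ⟨_, h'.swap₂₃⟩]

lemma AgreeOff.symm (h : AgreeOff K K' x y) : AgreeOff K' K x y :=
  fun u v h1 h2 h3 h4 => (h u v h1 h2 h3 h4).symm

lemma PathSet.symm {P : Finset V} (h : PathSet K P a b) : PathSet K P b a := by
  obtain ⟨h1, h2, h3, h4, h5, h6⟩ := h
  exact ⟨h2, h1, h3.symm, h5, h4, fun t ht hb ha => h6 t ht ha hb⟩

lemma PathSet.of_agreeOff {P : Finset V} (h : PathSet K P a b) (hK : AgreeOff K K' x y)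
    (hx : x ∉ P) (hy : y ∉ P) : PathSet K' P a b := by
  have key : ∀ u ∈ P, ∀ v ∈ P, K.Adj u v → K'.Adj u v := fun u hu v hv huv =>
    (hK u v (by rintro rfl; exact hx hu) (by rintro rfl; exact hy hu)
      (by rintro rfl; exact hx hv) (by rintro rfl; exact hy hv)).1 huv
  obtain ⟨h1, h2, h3, ⟨t, ht, hat⟩, ⟨r, hr, hbr⟩, h6⟩ := h
  refine ⟨h1, h2, h3, ⟨t, ht, key _ h1 _ ht hat⟩, ⟨r, hr, key _ h2 _ hr hbr⟩, ?_⟩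
  intro s hs ha hb
  obtain ⟨p, hp, q, hq, hpq, hsp, hsq⟩ := h6 s hs ha hb
  exact ⟨p, hp, q, hq, hpq, key _ hs _ hp hsp, key _ hs _ hq hsq⟩

variable [DecidableEq V]

lemma PathSet.minTwo_insert {P : Finset V} (h : PathSet K P a b) (hv : v ∉ P)
    (ha : K.Adj v a) (hb : K.Adj v b) : MinTwo K (insert v P) := by
  obtain ⟨h1, h2, h3, ⟨t, ht, hat⟩, ⟨r, hr, hbr⟩, h6⟩ := h
  intro s hs
  rcases Finset.mem_insert.1 hs with rfl | hs
  · exact ⟨a, by simp [h1], b, by simp [h2], h3, ha, hb⟩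
  by_cases hsa : s = a
  · subst hsa
    exact ⟨v, by simp, t, by simp [ht], by rintro rfl; exact hv ht, ha.symm, hat⟩
  by_cases hsb : s = b
  · subst hsb
    exact ⟨v, by simp, r, by simp [hr], by rintro rfl; exact hv hr, hb.symm, hbr⟩
  obtain ⟨p, hp, q, hq, hpq, hsp, hsq⟩ := h6 s hs hsa hsb
  exact ⟨p, by simp [hp], q, by simp [hq], hpq, hsp, hsq⟩

lemma PathSet.insert_adj {P : Finset V} (h : PathSet K P a b) (hv : v ∉ P)
    (ha : K.Adj v a) : PathSet K (insert v P) v b := by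
  obtain ⟨h1, h2, h3, ⟨t, ht, hat⟩, ⟨r, hr, hbr⟩, h6⟩ := h
  refine ⟨by simp, by simp [h2], by rintro rfl; exact hv h2, ⟨a, by simp [h1], ha⟩,
    ⟨r, by simp [hr], hbr⟩, ?_⟩
  intro s hs hsv hsb
  have hs := (Finset.mem_insert.1 hs).resolve_left hsv
  by_cases hsa : s = a
  · subst hsa
    exact ⟨v, by simp, t, by simp [ht], by rintro rfl; exact hv ht, ha.symm, hat⟩
  obtain ⟨p, hp, q, hq, hpq, hsp, hsq⟩ := h6 s hs hsa hsb
  exact ⟨p, by simp [hp], q, by simp [hq], hpq, hsp, hsq⟩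

lemma PathSet.erase {P : Finset V} (h : PathSet K P a b) (hv : v ∈ P) (hvb : v ≠ b)
    (hav : K.Adj a v) (huniq : ∀ t ∈ P, K.Adj a t → t = v) : PathSet K (P.erase a) v b := by
  obtain ⟨h1, h2, h3, -, ⟨r, hr, hbr⟩, h6⟩ := h
  refine ⟨by simp [hv, hav.ne'], by simp [h2, h3.symm], hvb, ?_, ⟨r, ?_, hbr⟩, ?_⟩
  · obtain ⟨p, hp, q, hq, hpq, hsp, hsq⟩ := h6 v hv hav.ne' hvb
    by_cases hpa : p = a
    · exact ⟨q, by simp [hq, hpa ▸ hpq.symm], hsq⟩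
    · exact ⟨p, by simp [hp, hpa], hsp⟩
  · refine Finset.mem_erase.2 ⟨?_, hr⟩
    rintro rfl
    exact hvb (huniq b h2 hbr.symm).symm
  · intro s hs hsv hsb
    obtain ⟨hsa, hs'⟩ := Finset.mem_erase.1 hs
    obtain ⟨p, hp, q, hq, hpq, hsp, hsq⟩ := h6 s hs' hsa hsb
    refine ⟨p, Finset.mem_erase.2 ⟨?_, hp⟩, q, Finset.mem_erase.2 ⟨?_, hq⟩, hpq, hsp, hsq⟩
    · rintro rfl; exact hsv (huniq s hs' hsp.symm)
    · rintro rfl; exact hsv (huniq s hs' hsq.symm)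

lemma MinTwo.pathSet_erase {s : Finset V} (h : MinTwo K s) (ha : a ∈ s) (hb : b ∈ s)
    (hab : a ≠ b) (hva : K.Adj v a) (hvb : K.Adj v b)
    (huniq : ∀ t ∈ s, K.Adj v t → t = a ∨ t = b) : PathSet K (s.erase v) a b := by
  have key : ∀ r ∈ s, ∃ t ∈ s.erase v, K.Adj r t := by
    intro r hr
    obtain ⟨p, hp, q, hq, hpq, hsp, hsq⟩ := h r hr
    by_cases hpv : p = v
    · exact ⟨q, by simp [hq, hpv ▸ hpq.symm], hsq⟩
    · exact ⟨p, by simp [hp, hpv], hsp⟩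
  refine ⟨by simp [ha, hva.ne'], by simp [hb, hvb.ne'], hab, key a ha, key b hb, ?_⟩
  intro t ht hta htb
  obtain ⟨htv, ht'⟩ := Finset.mem_erase.1 ht
  obtain ⟨p, hp, q, hq, hpq, hsp, hsq⟩ := h t ht'
  refine ⟨p, Finset.mem_erase.2 ⟨?_, hp⟩, q, Finset.mem_erase.2 ⟨?_, hq⟩, hpq, hsp, hsq⟩
  · rintro rfl; exact (huniq t ht' hsp.symm).elim hta htb
  · rintro rfl; exact (huniq t ht' hsq.symm).elim hta htb

end Basic

section Flip

variable {V : Type*} {Good : SimpleGraph V → Prop} {K : SimpleGraph V} {x y z z' p a b c d : V}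

open Classical in
lemma Nbrs.sum_eq_three [Fintype V] (h : Nbrs K x a b c) :
    ∑ t, (if K.Adj x t then 1 else 0) = 3 := by
  rw [Finset.sum_boole]
  have : Finset.univ.filter (fun t => K.Adj x t) = {a, b, c} := by
    ext t; simp [h.2.2.2 t]
  rw [this, Finset.card_eq_three.2 ⟨a, b, c, h.1, h.2.1, h.2.2.1, rfl⟩]
  rfl

/-- The numbers of neighbours among `x` and `y` are preserved by a flip at `x` and `y`. -/
lemma AgreeOff.count [Fintype V] {K' : SimpleGraph V} (hxy : x ≠ y) (h : AgreeOff K K' x y)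
    (hK : ∀ v, ∃ a b c, Nbrs K v a b c) (hK' : ∀ v, ∃ a b c, Nbrs K' v a b c) :
    (K'.Adj x y ↔ K.Adj x y) ∧ ∀ v, v ≠ x → v ≠ y →
      (K'.Adj x v ∧ K'.Adj y v ↔ K.Adj x v ∧ K.Adj y v) ∧
      (K'.Adj x v ∨ K'.Adj y v ↔ K.Adj x v ∨ K.Adj y v) := by
  classical
  have hsum : ∀ L : SimpleGraph V, (∀ v, ∃ a b c, Nbrs L v a b c) → ∀ v,
      ∑ t ∈ Finset.univ \ {x, y}, (if L.Adj v t then 1 else 0) +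
        ((if L.Adj x v then 1 else 0) + (if L.Adj y v then 1 else 0)) = 3 := by
    intro L hL v
    obtain ⟨a, b, c, hv⟩ := hL v
    rw [← hv.sum_eq_three, ← Finset.sum_sdiff (Finset.subset_univ {x, y}), Finset.sum_pair hxy,
      L.adj_comm x v, L.adj_comm y v]
  have hout : ∀ v, v ≠ x → v ≠ y →
      ((if K'.Adj x v then 1 else 0) + (if K'.Adj y v then 1 else 0) : ℕ) =
      (if K.Adj x v then 1 else 0) + (if K.Adj y v then 1 else 0) := by
    intro v hvx hvy
    have h1 := hsum K hK v
    have h2 := hsum K' hK' v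
    have h3 : ∑ t ∈ Finset.univ \ {x, y}, (if K'.Adj v t then 1 else 0) =
        ∑ t ∈ Finset.univ \ {x, y}, (if K.Adj v t then 1 else 0) := by
      refine Finset.sum_congr rfl fun t ht => ?_
      simp only [Finset.mem_sdiff, Finset.mem_univ, Finset.mem_insert, Finset.mem_singleton,
        not_or, true_and] at ht
      simp only [h v t hvx hvy ht.1 ht.2]
    omega
  constructor
  · have h1 := hsum K hK x
    have h2 := hsum K' hK' x
    have h3 := hsum K hK y
    have h4 := hsum K' hK' y
    have h5 : ∑ t ∈ Finset.univ \ {x, y}, (if K'.Adj x t then 1 else 0) +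
        ∑ t ∈ Finset.univ \ {x, y}, (if K'.Adj y t then 1 else 0) =
        ∑ t ∈ Finset.univ \ {x, y}, (if K.Adj x t then 1 else 0) +
        ∑ t ∈ Finset.univ \ {x, y}, (if K.Adj y t then 1 else 0) := by
      rw [← Finset.sum_add_distrib, ← Finset.sum_add_distrib]
      refine Finset.sum_congr rfl fun t ht => ?_
      simp only [Finset.mem_sdiff, Finset.mem_univ, Finset.mem_insert, Finset.mem_singleton,
        not_or, true_and] at ht
      exact hout t ht.1 ht.2
    simp only [SimpleGraph.irrefl, if_false, K.adj_comm y x, K'.adj_comm y x] at h1 h2 h3 h4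
    by_cases hA : K.Adj x y <;> by_cases hB : K'.Adj x y <;>
      simp only [hA, hB, if_true, if_false] at * <;> omega
  · intro v hvx hvy
    have := hout v hvx hvy
    by_cases h1 : K.Adj x v <;> by_cases h2 : K.Adj y v <;> by_cases h3 : K'.Adj x v <;>
      by_cases h4 : K'.Adj y v <;> simp_all

lemma AgreeOff.iso_of_same {K' : SimpleGraph V} (h : AgreeOff K K' x y)
    (hadj : K'.Adj x y ↔ K.Adj x y)
    (hv : ∀ v, v ≠ x → v ≠ y → (K'.Adj x v ↔ K.Adj x v) ∧ (K'.Adj y v ↔ K.Adj y v)) :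
    Nonempty (K ≃g K') := by
  have : K = K' := by
    ext u v
    have := K.adj_comm
    have := K'.adj_comm
    have := K.irrefl (v := x)
    have := K.irrefl (v := y)
    have := K'.irrefl (v := x)
    have := K'.irrefl (v := y)
    by_cases u = x <;> by_cases u = y <;> by_cases v = x <;> by_cases v = y <;> grind [AgreeOff]
  exact ⟨this ▸ Iso.refl⟩

lemma AgreeOff.comap_swap [DecidableEq V] {K' : SimpleGraph V} (h : AgreeOff K K' x y) :
    AgreeOff K (K'.comap (Equiv.swap x y)) x y := by
  intro u v h1 h2 h3 h4
  rw [comap_adj, Equiv.swap_apply_of_ne_of_ne h1 h2, Equiv.swap_apply_of_ne_of_ne h3 h4]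
  exact h u v h1 h2 h3 h4

lemma FlipClass.exists_flip [Fintype V] (hW : FlipClass Good) (hK : Good K) (hxy : x ≠ y) :
    ∃ K', Good K' ∧ AgreeOff K K' x y ∧ (K'.Adj x y ↔ K.Adj x y) ∧ (∀ v, v ≠ x → v ≠ y →
      (K'.Adj x v ∧ K'.Adj y v ↔ K.Adj x v ∧ K.Adj y v) ∧
      (K'.Adj x v ∨ K'.Adj y v ↔ K.Adj x v ∨ K.Adj y v)) ∧
    (¬ ∀ v, v ≠ x → v ≠ y → (K'.Adj x v ↔ K.Adj x v) ∧ (K'.Adj y v ↔ K.Adj y v)) ∧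
    (¬ ∀ v, v ≠ x → v ≠ y → (K'.Adj x v ↔ K.Adj y v) ∧ (K'.Adj y v ↔ K.Adj x v)) := by
  classical
  obtain ⟨K', hK', hiso, hag⟩ := hW.flip hK hxy
  obtain ⟨h1, h2⟩ := hag.count hxy (hW.nbrs hK) (hW.nbrs hK')
  refine ⟨K', hK', hag, h1, h2, fun h => ?_, fun h => ?_⟩
  · exact not_isEmpty_iff.2 (hag.iso_of_same h1 h) hiso
  · obtain ⟨e⟩ := hag.comap_swap.iso_of_same (by simpa [K'.adj_comm y x] using h1) (by
      intro v hvx hvy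
      simpa [Equiv.swap_apply_of_ne_of_ne hvx hvy] using (h v hvx hvy).symm)
    exact hiso.false (e.trans (Iso.comap (Equiv.swap x y) K'))

lemma FlipClass.not_common [Fintype V] (hW : FlipClass Good) (hK : Good K) (hxy : x ≠ y)
    (hx : Nbrs K x z p a) (hy : Nbrs K y z' p c) (hz : (z = y ∧ z' = x) ∨ z = z') : False := by
  obtain ⟨K', hK', hag, h1, h2, h3, h4⟩ := hW.exists_flip hK hxy
  obtain ⟨_, _, _, hr⟩ := hW.nbrs hK' x
  obtain ⟨_, _, _, hr'⟩ := hW.nbrs hK' y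
  have hp1 : K'.Adj x p ∧ K'.Adj y p := by
    refine (h2 p ?_ ?_).1.2 ⟨hx.adj₂, hy.adj₂⟩
    exacts [hx.adj₂.ne', hy.adj₂.ne']
  have hz1 : K'.Adj x z ∧ K'.Adj y z' := by
    rcases hz with ⟨rfl, rfl⟩ | rfl
    · exact ⟨h1.2 hx.adj₁, (h1.2 hx.adj₁).symm⟩
    · exact (h2 z hx.adj₁.ne' hy.adj₁.ne').1.2 ⟨hx.adj₁, hy.adj₁⟩
  obtain ⟨r, hr⟩ := hr.exists_of_adj_of_adj hz1.1 hp1.1 hx.1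
  obtain ⟨r', hr'⟩ := hr'.exists_of_adj_of_adj hz1.2 hp1.2 hy.1
  have := K.adj_comm x y
  have := K'.adj_comm x y
  have := K'.irrefl (v := x)
  have := K'.irrefl (v := y)
  have := K.irrefl (v := x)
  have := K.irrefl (v := y)
  have := h2 r
  have := h2 r'
  have := h2 a
  have := h2 c
  clear hag
  obtain ⟨x1, x2, x3, hx⟩ := hx
  obtain ⟨y1, y2, y3, hy⟩ := hy
  obtain ⟨r1, r2, r3, hr⟩ := hr
  obtain ⟨s1, s2, s3, hr'⟩ := hr'
  simp only [hx, hy, hr, hr'] at *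
  grind

end Flip

section Girth

variable {V : Type*} [Fintype V] {Good : SimpleGraph V → Prop} {K : SimpleGraph V} {x y p q : V}

lemma FlipClass.not_triangle (hW : FlipClass Good) (hK : Good K) (hxy : K.Adj x y)
    (hx : K.Adj x p) (hy : K.Adj y p) : False := by
  obtain ⟨_, _, _, h1⟩ := hW.nbrs hK x
  obtain ⟨_, _, _, h2⟩ := hW.nbrs hK y
  obtain ⟨_, h1⟩ := h1.exists_of_adj_of_adj hxy hx hy.ne
  obtain ⟨_, h2⟩ := h2.exists_of_adj_of_adj hxy.symm hy hx.ne
  exact hW.not_common hK hxy.ne h1 h2 (Or.inl ⟨rfl, rfl⟩)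

lemma FlipClass.eq_of_adj (hW : FlipClass Good) (hK : Good K) (hxy : x ≠ y)
    (hxp : K.Adj x p) (hyp : K.Adj y p) (hxq : K.Adj x q) (hyq : K.Adj y q) : p = q := by
  by_contra hpq
  obtain ⟨_, _, _, h1⟩ := hW.nbrs hK x
  obtain ⟨_, _, _, h2⟩ := hW.nbrs hK y
  obtain ⟨_, h1⟩ := h1.exists_of_adj_of_adj hxp hxq hpq
  obtain ⟨_, h2⟩ := h2.exists_of_adj_of_adj hyp hyq hpq
  exact hW.not_common hK hxy h1 h2 (Or.inr rfl)

lemma FlipClass.largeGirth_five (hW : FlipClass Good) (hK : Good K) : LargeGirth K 5 := by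
  classical
  rintro s ⟨v, hv⟩ hs
  obtain ⟨u, hu, w, hw, huw, hvu, hvw⟩ := hs v hv
  have other : ∀ u ∈ s, ∃ u' ∈ s, u' ≠ v ∧ K.Adj u u' := by
    intro u hu
    obtain ⟨p, hp, q, hq, hpq, h1, h2⟩ := hs u hu
    by_cases hpv : p = v
    · exact ⟨q, hq, by rintro rfl; exact hpq hpv, h2⟩
    · exact ⟨p, hp, hpv, h1⟩
  obtain ⟨u', hu', huv', huu'⟩ := other u hu
  obtain ⟨w', hw', hwv', hww'⟩ := other w hw
  have h1 : u' ≠ w := by rintro rfl; exact hW.not_triangle hK hvu hvw huu'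
  have h2 : w' ≠ u := by rintro rfl; exact hW.not_triangle hK hvw hvu hww'
  have h3 : u' ≠ w' := by
    rintro rfl
    exact huw (hW.eq_of_adj hK huv'.symm hvu huu'.symm hvw hww'.symm)
  have hsub : ({v, u, w, u', w'} : Finset V) ⊆ s := by
    intro t ht
    simp only [Finset.mem_insert, Finset.mem_singleton] at ht
    rcases ht with rfl | rfl | rfl | rfl | rfl <;> assumption
  have := Finset.card_le_card hsub
  rwa [Finset.card_insert_of_notMem, Finset.card_insert_of_notMem, Finset.card_insert_of_notMem,
    Finset.card_insert_of_notMem, Finset.card_singleton] at this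
  all_goals simp only [Finset.mem_insert, Finset.mem_singleton, not_or]
  exacts [h3, ⟨h1.symm, hww'.ne⟩, ⟨huw, huu'.ne, h2.symm⟩,
    ⟨hvu.ne, hvw.ne, huv'.symm, hwv'.symm⟩]

end Girth

open Classical in
/-- A flip class of graphs of girth at least `g` with the same number of `g`-cycles. -/
structure GirthClass {V : Type*} [Fintype V] (Good : SimpleGraph V → Prop) (g : ℕ) : Prop
    extends FlipClass Good where
  largeGirth : ∀ {K}, Good K → LargeGirth K g
  card_eq : ∀ {K K'}, Good K → Good K' →
    (Finset.univ.filter (IsGCycle K g)).card = (Finset.univ.filter (IsGCycle K' g)).card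
  five_le : 5 ≤ g

section GirthClass

variable {V : Type*} [Fintype V] [DecidableEq V] {Good : SimpleGraph V → Prop} {g : ℕ}
  {K K' : SimpleGraph V} {x y z z' a b c d u v w : V} {s t Q : Finset V}

lemma GirthClass.not_pathSet (hW : GirthClass Good g) (hK : Good K) (hQ : PathSet K Q a b)
    (hx : x ∉ Q) (hxa : K.Adj x a) (hxb : K.Adj x b) (hcard : Q.card + 1 < g) : False := by
  have := hW.largeGirth hK _ ⟨x, by simp⟩ (hQ.minTwo_insert hx hxa hxb)
  rw [Finset.card_insert_of_notMem hx] at this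
  omega

omit [Fintype V] in
lemma Nbrs.comap_swap (h : Nbrs K x a b c) (y : V) :
    Nbrs (K.comap (Equiv.swap x y)) y (Equiv.swap x y a) (Equiv.swap x y b)
      (Equiv.swap x y c) := by
  obtain ⟨h1, h2, h3, h4⟩ := h
  refine ⟨by simpa, by simpa, by simpa, fun t => ?_⟩
  rw [comap_adj, Equiv.swap_apply_right, h4]
  simp only [Equiv.swap_apply_eq_iff]

omit [Fintype V] [DecidableEq V] in
lemma Nbrs.eq_of_adj (h : Nbrs K v a b c) (hx : K.Adj v x) (ha : x ≠ a) (hb : x ≠ b) : x = c :=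
  (((h.2.2.2 x).1 hx).resolve_left ha).resolve_left hb

/-- Two neighbours of the flipped vertices are exchanged, if the other exchange is excluded by a
short path. -/
lemma GirthClass.flip_exchange (hW : GirthClass Good g) (hK : Good K) (hx : Nbrs K x z a b)
    (hy : Nbrs K y z' c d) (hz : (z = y ∧ z' = x) ∨ z = z') (hxy : x ≠ y)
    (hQ : PathSet K Q a c) (hxQ : x ∉ Q) (hyQ : y ∉ Q) (hcard : Q.card + 1 < g) :
    ∃ K', Good K' ∧ AgreeOff K K' x y ∧ Nbrs K' x z a d ∧ Nbrs K' y z' c b := by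
  obtain ⟨K', hK', hag, h1, h2, h3, h4⟩ := hW.exists_flip hK hxy
  have hQ' := hQ.of_agreeOff hag hxQ hyQ
  have hkx : ¬ (K'.Adj x a ∧ K'.Adj x c) := fun h => hW.not_pathSet hK' hQ' hxQ h.1 h.2 hcard
  have hky : ¬ (K'.Adj y a ∧ K'.Adj y c) := fun h => hW.not_pathSet hK' hQ' hyQ h.1 h.2 hcard
  have hcom : ∀ t, t ≠ z → t = a ∨ t = b → ¬ K.Adj y t := by
    intro t htz ht hyt
    have hxt : K.Adj x t := (hx.2.2.2 t).2 (Or.inr ht)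
    rcases hz with ⟨rfl, rfl⟩ | rfl
    · exact hW.not_triangle hK hx.adj₁ hxt hyt
    · exact htz (hW.eq_of_adj hK hxy hxt hyt hx.adj₁ hy.adj₁)
  have hnadj : z = z' → ¬ K.Adj x y := by
    rintro rfl h
    exact hW.not_triangle hK h hx.adj₁ hy.adj₁
  have hz1 : K'.Adj x z ∧ K'.Adj y z' := by
    rcases hz with ⟨rfl, rfl⟩ | rfl
    · exact ⟨h1.2 hx.adj₁, (h1.2 hx.adj₁).symm⟩
    · exact (h2 z hx.adj₁.ne' hy.adj₁.ne').1.2 ⟨hx.adj₁, hy.adj₁⟩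
  obtain ⟨_, _, _, hr⟩ := hW.nbrs hK' x
  obtain ⟨_, _, _, hr'⟩ := hW.nbrs hK' y
  obtain ⟨r, s, hr⟩ := hr.exists_of_adj hz1.1
  obtain ⟨r', s', hr'⟩ := hr'.exists_of_adj hz1.2
  have hax := hx.adj₂.ne'
  have hbx := hx.adj₃.ne'
  have hcy := hy.adj₂.ne'
  have hdy := hy.adj₃.ne'
  have hay : a ≠ y := by
    rintro rfl
    rcases hz with ⟨rfl, rfl⟩ | rfl
    exacts [hx.1 rfl, hnadj rfl hx.adj₂]
  have hby : b ≠ y := by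
    rintro rfl
    rcases hz with ⟨rfl, rfl⟩ | rfl
    exacts [hx.2.1 rfl, hnadj rfl hx.adj₃]
  have hcx : c ≠ x := by
    rintro rfl
    rcases hz with ⟨rfl, rfl⟩ | rfl
    exacts [hy.1 rfl, hnadj rfl hy.adj₂.symm]
  have hdx : d ≠ x := by
    rintro rfl
    rcases hz with ⟨rfl, rfl⟩ | rfl
    exacts [hy.2.1 rfl, hnadj rfl hy.adj₃.symm]
  have hya := hcom a hx.1.symm (Or.inl rfl)
  have hyb := hcom b hx.2.1.symm (Or.inr rfl)
  have hac : a ≠ c := by rintro rfl; exact hya hy.adj₂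
  have had : a ≠ d := by rintro rfl; exact hya hy.adj₃
  have hbc : b ≠ c := by rintro rfl; exact hyb hy.adj₂
  have hbd : b ≠ d := by rintro rfl; exact hyb hy.adj₃
  have hzc : c ≠ z := by
    rcases hz with ⟨rfl, rfl⟩ | rfl
    exacts [hcy, hy.1.symm]
  have hzd : d ≠ z := by
    rcases hz with ⟨rfl, rfl⟩ | rfl
    exacts [hdy, hy.2.1.symm]
  have key : (Nbrs K' x z a d ∧ Nbrs K' y z' c b) ∨ (Nbrs K' x z c b ∧ Nbrs K' y z' a d) := by
    have hnr : ∀ t, K'.Adj x t → t ≠ z → t = a ∨ t = b ∨ t = c ∨ t = d := by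
      intro t hxt htz
      have hor : K.Adj x t ∨ K.Adj y t := by
        by_cases hty : t = y
        · exact Or.inl (hty ▸ h1.1 (hty ▸ hxt))
        · exact (h2 t hxt.ne' hty).2.1 (Or.inl hxt)
      rcases hor with h | h
      · rcases (hx.2.2.2 t).1 h with h | h | h
        exacts [absurd h htz, Or.inl h, Or.inr (Or.inl h)]
      · rcases (hy.2.2.2 t).1 h with h | h | h
        · rcases hz with ⟨-, hz⟩ | hz
          exacts [absurd (h.trans hz) hxt.ne', absurd (h.trans hz.symm) htz]
        exacts [Or.inr (Or.inr (Or.inl h)), Or.inr (Or.inr (Or.inr h))]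
    have exc : ∀ t, t ≠ x → t ≠ y → (K.Adj x t ↔ ¬ K.Adj y t) → (K'.Adj y t ↔ ¬ K'.Adj x t) := by
      intro t htx hty h
      obtain ⟨e1, e2⟩ := h2 t htx hty
      refine ⟨fun hy hx => h.1 (e1.1 ⟨hx, hy⟩).1 (e1.1 ⟨hx, hy⟩).2, fun hx => ?_⟩
      exact (e2.2 ((em (K.Adj y t)).elim Or.inr fun n => Or.inl (h.2 n))).resolve_left hx
    have hya' := exc a hax hay (by simp [hx.adj₂, hya])
    have hyb' := exc b hbx hby (by simp [hx.adj₃, hyb])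
    have hyc' := exc c hcx hcy (by simp [hx.2.2.2, hy.adj₂, hac.symm, hbc.symm, hzc])
    have hyd' := exc d hdx hdy (by simp [hx.2.2.2, hy.adj₃, had.symm, hbd.symm, hzd])
    have hz'a : z' ≠ a := by
      rcases hz with ⟨rfl, rfl⟩ | rfl
      exacts [hax.symm, hx.1]
    have hz'b : z' ≠ b := by
      rcases hz with ⟨rfl, rfl⟩ | rfl
      exacts [hbx.symm, hx.2.1]
    by_cases hA : K'.Adj x a
    · left
      have hC : ¬ K'.Adj x c := fun h => hkx ⟨hA, h⟩
      obtain ⟨q, hq⟩ := hr.exists_of_adj_of_adj hz1.1 hA hx.1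
      obtain ⟨q', hq'⟩ := hr'.exists_of_adj_of_adj hz1.2 (hyc'.2 hC) hy.1
      by_cases hD : K'.Adj x d
      · obtain rfl := hq.eq_of_adj hD hzd had.symm
        have hB : ¬ K'.Adj x b := fun h => hbd (hq.eq_of_adj h hx.2.1.symm hx.2.2.1.symm)
        obtain rfl := hq'.eq_of_adj (hyb'.2 hB) hz'b.symm hbc
        exact ⟨hq, hq'⟩
      · exfalso
        obtain rfl := hq'.eq_of_adj (hyd'.2 hD) hy.2.1.symm hy.2.2.1.symm
        rcases hnr q hq.adj₃ hq.2.1.symm with rfl | rfl | rfl | rfl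
        · exact hq.2.2.1 rfl
        · exact h3 fun v _ _ => ⟨(hq.2.2.2 v).trans (hx.2.2.2 v).symm,
            (hq'.2.2.2 v).trans (hy.2.2.2 v).symm⟩
        · exact hC hq.adj₃
        · exact hD hq.adj₃
    · right
      have hC : K'.Adj x c := by
        by_contra h
        exact hky ⟨hya'.2 hA, hyc'.2 h⟩
      obtain ⟨q, hq⟩ := hr.exists_of_adj_of_adj hz1.1 hC hzc.symm
      obtain ⟨q', hq'⟩ := hr'.exists_of_adj_of_adj hz1.2 (hya'.2 hA) hz'a
      by_cases hB : K'.Adj x b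
      · obtain rfl := hq.eq_of_adj hB hx.2.1.symm hbc
        have hD : ¬ K'.Adj x d := fun h => hbd.symm (hq.eq_of_adj h hzd hy.2.2.1.symm)
        obtain rfl := hq'.eq_of_adj (hyd'.2 hD) hy.2.1.symm had.symm
        exact ⟨hq, hq'⟩
      · exfalso
        obtain rfl := hq'.eq_of_adj (hyb'.2 hB) hz'b.symm hx.2.2.1.symm
        rcases hnr q hq.adj₃ hq.2.1.symm with rfl | rfl | rfl | rfl
        · exact hA hq.adj₃
        · exact hB hq.adj₃
        · exact hq.2.2.1 rfl
        · refine h4 fun v hvx hvy => ?_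
          rw [hq.2.2.2 v, hq'.2.2.2 v, hx.2.2.2 v, hy.2.2.2 v]
          rcases hz with ⟨rfl, rfl⟩ | rfl
          · simp [hvx, hvy]
          · exact ⟨Iff.rfl, Iff.rfl⟩
  have hsz : Equiv.swap x y z = z' ∧ Equiv.swap x y z' = z := by
    rcases hz with ⟨rfl, rfl⟩ | rfl
    · simp
    · simp [Equiv.swap_apply_of_ne_of_ne hx.adj₁.ne' hy.adj₁.ne']
  rcases key with h | h
  · exact ⟨K', hK', hag, h⟩
  · refine ⟨K'.comap (Equiv.swap x y), hW.iso hK' ⟨(Iso.comap (Equiv.swap x y) K').symm⟩,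
      hag.comap_swap, ?_, ?_⟩
    · have := h.2.comap_swap x
      rw [Equiv.swap_comm] at this
      rwa [Equiv.swap_apply_of_ne_of_ne hax hay, Equiv.swap_apply_of_ne_of_ne hdx hdy,
        hsz.2] at this
    · have := h.1.comap_swap y
      rwa [Equiv.swap_apply_of_ne_of_ne hcx hcy, Equiv.swap_apply_of_ne_of_ne hbx hby,
        hsz.1] at this

end GirthClass

section Cycles

variable {V : Type*} [DecidableEq V] {g : ℕ}
  {K K' : SimpleGraph V} {x y a b c d u v w p q : V} {s t P : Finset V}

lemma IsGCycle.mem_cases (hs : IsGCycle K g s) (hK : LargeGirth K g) (hv : v ∈ s)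
    (h : Nbrs K v a b c) :
    (a ∈ s ∧ b ∈ s ∧ c ∉ s) ∨ (a ∈ s ∧ b ∉ s ∧ c ∈ s) ∨ (a ∉ s ∧ b ∈ s ∧ c ∈ s) := by
  obtain ⟨p, hp, q, hq, hpq, hn⟩ := hs.two_neighbors hK hv
  have ha := fun h' => (hn a h').1 h.adj₁
  have hb := fun h' => (hn b h').1 h.adj₂
  have hc := fun h' => (hn c h').1 h.adj₃
  have hp' := (h.2.2.2 p).1 ((hn p hp).2 (Or.inl rfl))
  have hq' := (h.2.2.2 q).1 ((hn q hq).2 (Or.inr rfl))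
  obtain ⟨h1, h2, h3, -⟩ := h
  grind

lemma IsGCycle.notMem (hs : IsGCycle K g s) (hK : LargeGirth K g) (h : Nbrs K v a b c)
    (hv : v ∈ s) (ha : a ∈ s) (hb : b ∈ s) : c ∉ s := by
  rcases hs.mem_cases hK hv h with h | h | h
  exacts [h.2.2, absurd hb h.2.1, absurd ha h.1]

lemma IsGCycle.mem_of_notMem (hs : IsGCycle K g s) (hK : LargeGirth K g) (h : Nbrs K v a b c)
    (hv : v ∈ s) (hc : c ∉ s) : a ∈ s ∧ b ∈ s := by
  rcases hs.mem_cases hK hv h with h | h | h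
  exacts [⟨h.1, h.2.1⟩, absurd h.2.2 hc, absurd h.2.2 hc]

lemma IsGCycle.pathSet_erase (hs : IsGCycle K g s) (h : Nbrs K v a b c) (ha : a ∈ s)
    (hb : b ∈ s) (hc : c ∉ s) : PathSet K (s.erase v) a b :=
  hs.2.pathSet_erase ha hb h.1 h.adj₁ h.adj₂ fun t ht hvt => by
    rcases (h.2.2.2 t).1 hvt with h | h | h
    exacts [Or.inl h, Or.inr h, absurd (h ▸ ht) hc]

lemma PathSet.erase_of_nbrs (hP : PathSet K P a b) (h : Nbrs K a v p q) (hv : v ∉ P) (hq : q ∉ P)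
    (hpb : p ≠ b) : PathSet K (P.erase a) p b := by
  have key : ∀ t ∈ P, K.Adj a t → t = p := by
    intro t ht hat
    rcases (h.2.2.2 t).1 hat with h | h | h
    exacts [absurd (h ▸ ht) hv, h, absurd (h ▸ ht) hq]
  obtain ⟨t, ht, hat⟩ := hP.2.2.2.1
  exact hP.erase (key t ht hat ▸ ht) hpb h.adj₂ key

lemma PathSet.isGCycle_insert (hP : PathSet K P a b) (hv : v ∉ P) (ha : K.Adj v a)
    (hb : K.Adj v b) (hcard : P.card + 1 = g) : IsGCycle K g (insert v P) :=
  ⟨by rw [Finset.card_insert_of_notMem hv, hcard], hP.minTwo_insert hv ha hb⟩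

lemma PathSet.isGCycle_insert_insert (hP : PathSet K P a b) (hv : v ∉ P) (hw : w ∉ P)
    (ha : K.Adj v a) (hb : K.Adj w b) (hvw : K.Adj v w) (hcard : P.card + 2 = g) :
    IsGCycle K g (insert w (insert v P)) :=
  (hP.insert_adj hv ha).isGCycle_insert (by simp [hw, hvw.ne']) hvw.symm hb
    (by rw [Finset.card_insert_of_notMem hv]; omega)

lemma Finset.card_erase_erase_add_two (hx : x ∈ s) (hy : y ∈ s) (hxy : x ≠ y) :
    ((s.erase x).erase y).card + 2 = s.card := by
  have h1 := Finset.card_erase_add_one (s := s.erase x) (a := y) (by simp [hy, hxy.symm])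
  have h2 := Finset.card_erase_add_one hx
  omega

lemma Finset.insert_insert_erase_erase (hx : x ∈ s) (hy : y ∈ s) (hxy : x ≠ y) :
    insert x (insert y ((s.erase x).erase y)) = s := by
  rw [Finset.insert_erase (by simp [hy, hxy.symm]), Finset.insert_erase hx]

/-- Deleting two adjacent vertices from a `g`-cycle leaves a path. -/
lemma IsGCycle.pathSet_erase_erase (hs : IsGCycle K g s) (h : Nbrs K x y a b)
    (h' : Nbrs K y x c d) (hy : y ∈ s) (ha : a ∈ s) (hb : b ∉ s) (hd : d ∉ s)
    (hac : a ≠ c) : PathSet K ((s.erase x).erase y) c a :=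
  (hs.pathSet_erase h hy ha hb).erase_of_nbrs h' (by simp)
    (fun h => hd (Finset.mem_of_mem_erase h)) hac.symm

end Cycles

section GirthClass

variable {V : Type*} [Fintype V] {Good : SimpleGraph V → Prop} {g : ℕ}
  {K K' : SimpleGraph V} {x y a b c d u v w p q r : V} {s t Q : Finset V}

lemma GirthClass.nbrs_of_adj (hW : GirthClass Good g) (hK : Good K) (ha : K.Adj v a)
    (hb : K.Adj v b) (hc : K.Adj v c) (hab : a ≠ b) (hac : a ≠ c) (hbc : b ≠ c) :
    Nbrs K v a b c := by
  obtain ⟨_, _, _, h⟩ := hW.nbrs hK v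
  obtain ⟨d, h⟩ := h.exists_of_adj_of_adj ha hb hab
  rwa [h.eq_of_adj hc hac.symm hbc.symm]

lemma GirthClass.ne_of_adj (hW : GirthClass Good g) (hK : Good K) (hxy : K.Adj x y)
    (hx : K.Adj x p) (hy : K.Adj y q) : p ≠ q := by
  rintro rfl
  exact hW.not_triangle hK hxy hx hy

/-- A flip at two vertices preserves the number of `g`-cycles through these vertices. -/
lemma GirthClass.exists_notMem (hW : GirthClass Good g) (hK : Good K) (hK' : Good K')
    (hag : AgreeOff K K' x y) {A B : Finset (Finset V)}
    (hA : ∀ s ∈ A, IsGCycle K g s ∧ (x ∈ s ∨ y ∈ s)) (hcard : B.card < A.card) :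
    ∃ s, IsGCycle K' g s ∧ (x ∈ s ∨ y ∈ s) ∧ s ∉ B := by
  classical
  by_contra! hcon
  have h := hW.card_eq hK hK'
  rw [← Finset.card_filter_add_card_filter_not (fun s => x ∈ s ∨ y ∈ s),
    ← Finset.card_filter_add_card_filter_not (s := Finset.univ.filter (IsGCycle K' g))
      (fun s => x ∈ s ∨ y ∈ s)] at h
  have h1 : A.card ≤ ((Finset.univ.filter (IsGCycle K g)).filter
      (fun s => x ∈ s ∨ y ∈ s)).card := Finset.card_le_card fun s hs => by simpa using hA s hs
  have h2 : ((Finset.univ.filter (IsGCycle K' g)).filter (fun s => x ∈ s ∨ y ∈ s)).card ≤ B.card :=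
    Finset.card_le_card fun s hs => by
      simp only [Finset.mem_filter, Finset.mem_univ, true_and] at hs
      exact hcon s hs.1 hs.2
  have h3 : (Finset.univ.filter (IsGCycle K g)).filter (fun s => ¬ (x ∈ s ∨ y ∈ s)) =
      (Finset.univ.filter (IsGCycle K' g)).filter (fun s => ¬ (x ∈ s ∨ y ∈ s)) := by
    have key : ∀ L L' : SimpleGraph V, AgreeOff L L' x y → ∀ s, ¬ (x ∈ s ∨ y ∈ s) →
        IsGCycle L g s → IsGCycle L' g s := by
      intro L L' hL s hs h
      refine ⟨h.1, fun v hv => ?_⟩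
      have hne : ∀ t ∈ s, t ≠ x ∧ t ≠ y := fun t ht =>
        ⟨by rintro rfl; exact hs (Or.inl ht), by rintro rfl; exact hs (Or.inr ht)⟩
      obtain ⟨u, hu, w, hw, huw, h1, h2⟩ := h.2 v hv
      exact ⟨u, hu, w, hw, huw,
        (hL v u (hne v hv).1 (hne v hv).2 (hne u hu).1 (hne u hu).2).1 h1,
        (hL v w (hne v hv).1 (hne v hv).2 (hne w hw).1 (hne w hw).2).1 h2⟩
    ext s
    simp only [Finset.mem_filter, Finset.mem_univ, true_and]
    exact ⟨fun h => ⟨key K K' hag s h.2 h.1, h.2⟩, fun h => ⟨key K' K hag.symm s h.2 h.1, h.2⟩⟩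
  rw [h3] at h
  omega

variable [DecidableEq V]

lemma GirthClass.not_diverge (hW : GirthClass Good g) (hK : Good K) (hs : IsGCycle K g s)
    (ht : IsGCycle K g t) (hv : Nbrs K v w u r) (hw : Nbrs K w v p q) (hvs : v ∈ s) (hws : w ∈ s)
    (hus : u ∈ s) (hps : p ∈ s) (hvt : v ∈ t) (hwt : w ∈ t) (hut : u ∈ t) (hqt : q ∈ t) :
    False := by
  have hg := hW.largeGirth hK
  have hg5 := hW.five_le
  have hup := hW.ne_of_adj hK hv.adj₁ hv.adj₂ hw.adj₂
  have huq := hW.ne_of_adj hK hv.adj₁ hv.adj₂ hw.adj₃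
  have hvw := hv.adj₁.ne
  have hS := hs.pathSet_erase_erase hv hw hws hus (hs.notMem hg hv hvs hws hus)
    (hs.notMem hg hw hws hvs hps) hup
  have hT := ht.pathSet_erase_erase hv hw.swap₂₃ hwt hut (ht.notMem hg hv hvt hwt hut)
    (ht.notMem hg hw.swap₂₃ hwt hvt hqt) huq
  have hcS := Finset.card_erase_erase_add_two hvs hws hvw
  have hcT := Finset.card_erase_erase_add_two hvt hwt hvw
  rw [hs.1] at hcS
  rw [ht.1] at hcT
  obtain ⟨K', hK', hag, hv', hw'⟩ := hW.flip_exchange hK hv hw (Or.inl ⟨rfl, rfl⟩) hvw hS.symm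
    (by simp) (by simp) (by omega)
  exact hW.not_pathSet hK' (hT.of_agreeOff hag (by simp) (by simp)) (by simp) hv'.adj₃ hv'.adj₂
    (by omega)

/-- Two `g`-cycles sharing a path of length two are equal. -/
lemma GirthClass.eq_of_mem (hW : GirthClass Good g) (hK : Good K) (hs : IsGCycle K g s)
    (ht : IsGCycle K g t) (hvu : K.Adj v u) (hvw : K.Adj v w) (huw : u ≠ w) (hvs : v ∈ s)
    (hus : u ∈ s) (hws : w ∈ s) (hvt : v ∈ t) (hut : u ∈ t) (hwt : w ∈ t) : s = t := by
  classical
  have hg := hW.largeGirth hK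
  set A := s.filter (fun v => v ∈ t ∧ ∀ r, K.Adj v r → (r ∈ s ↔ r ∈ t)) with hA
  have hstart : v ∈ A := by
    obtain ⟨_, _, _, h⟩ := hW.nbrs hK v
    obtain ⟨r, h⟩ := h.exists_of_adj_of_adj hvu hvw huw
    have h1 := hs.mem_cases hg hvs h
    have h2 := ht.mem_cases hg hvt h
    refine Finset.mem_filter.2 ⟨hvs, hvt, fun p hp => ?_⟩
    rcases (h.2.2.2 p).1 hp with rfl | rfl | rfl
    · simp [hus, hut]
    · simp [hws, hwt]
    · tauto
  have hstep : ∀ v ∈ A, ∀ w ∈ s, K.Adj v w → w ∈ A := by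
    intro v hv w hws hvw
    obtain ⟨hvs, hvt, hst⟩ := Finset.mem_filter.1 hv
    obtain ⟨u, hu, huw, hvu⟩ : ∃ u ∈ s, u ≠ w ∧ K.Adj v u := by
      obtain ⟨p, hp, q, hq, hpq, h1, h2⟩ := hs.2 v hvs
      by_cases hpw : p = w
      · exact ⟨q, hq, by rintro rfl; exact hpq hpw, h2⟩
      · exact ⟨p, hp, hpw, h1⟩
    have hwt := (hst w hvw).1 hws
    have hut := (hst u hvu).1 hu
    obtain ⟨_, _, _, h⟩ := hW.nbrs hK v
    obtain ⟨r, h⟩ := h.exists_of_adj_of_adj hvw hvu huw.symm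
    obtain ⟨_, _, _, h'⟩ := hW.nbrs hK w
    obtain ⟨p, q, h'⟩ := h'.exists_of_adj hvw.symm
    have h1 := hs.mem_cases hg hws h'
    have h2 := ht.mem_cases hg hwt h'
    have h3 : ¬ (p ∈ s ∧ q ∈ t) := fun hpq =>
      hW.not_diverge hK hs ht h h' hvs hws hu hpq.1 hvt hwt hut hpq.2
    have h4 : ¬ (q ∈ s ∧ p ∈ t) := fun hpq =>
      hW.not_diverge hK hs ht h h'.swap₂₃ hvs hws hu hpq.1 hvt hwt hut hpq.2
    refine Finset.mem_filter.2 ⟨hws, hwt, fun l hl => ?_⟩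
    rcases (h'.2.2.2 l).1 hl with rfl | rfl | rfl <;> tauto
  have hmin : MinTwo K A := by
    intro v hv
    obtain ⟨p, hp, q, hq, hpq, h1, h2⟩ := hs.2 v (Finset.mem_filter.1 hv).1
    exact ⟨p, hstep v hv p hp h1, q, hstep v hv q hq h2, hpq, h1, h2⟩
  have hcard := hg A ⟨v, hstart⟩ hmin
  have hAs : A = s := Finset.eq_of_subset_of_card_le (Finset.filter_subset _ _) (hs.1 ▸ hcard)
  have hAt : A = t := Finset.eq_of_subset_of_card_le
    (fun v hv => (Finset.mem_filter.1 hv).2.1) (ht.1 ▸ hcard)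
  exact hAs.symm.trans hAt

end GirthClass

/-- Three `g`-cycles through a vertex `x`, with the neighbourhoods of `x` and its neighbours. -/
structure Config {V : Type*} (K : SimpleGraph V) (g : ℕ) (x y a b c d a₁ a₂ b₁ b₂ : V)
    (sya syb sab : Finset V) : Prop where
  nx : Nbrs K x y a b
  ny : Nbrs K y x c d
  na : Nbrs K a x a₁ a₂
  nb : Nbrs K b x b₁ b₂
  cya : IsGCycle K g sya
  cyb : IsGCycle K g syb
  cab : IsGCycle K g sab
  mya : x ∈ sya ∧ y ∈ sya ∧ a ∈ sya ∧ b ∉ sya ∧ c ∈ sya ∧ d ∉ sya ∧ a₁ ∈ sya ∧ a₂ ∉ sya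
  myb : x ∈ syb ∧ y ∈ syb ∧ b ∈ syb ∧ a ∉ syb ∧ d ∈ syb ∧ c ∉ syb ∧ b₁ ∈ syb ∧ b₂ ∉ syb
  mab : x ∈ sab ∧ a ∈ sab ∧ b ∈ sab ∧ y ∉ sab ∧ a₂ ∈ sab ∧ a₁ ∉ sab ∧ b₂ ∈ sab ∧ b₁ ∉ sab

/-- There is a path on `g - 2` vertices from `u` to `v` avoiding `x`, `y` and `a`. -/
def Core {V : Type*} (K : SimpleGraph V) (g : ℕ) (x y a u v : V) : Prop :=
  ∃ Q : Finset V, Q.card + 2 = g ∧ PathSet K Q u v ∧ x ∉ Q ∧ y ∉ Q ∧ a ∉ Q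

section Config

variable {V : Type*} {K : SimpleGraph V} {g : ℕ}
  {x y a b c d a₁ a₂ b₁ b₂ u v : V} {sya syb sab : Finset V}

lemma Core.symm (h : Core K g x y a u v) : Core K g x y a v u := by
  obtain ⟨Q, h1, h2, h3⟩ := h
  exact ⟨Q, h1, h2.symm, h3⟩

lemma Core.swap (h : Core K g x y a u v) : Core K g x a y u v := by
  obtain ⟨Q, h1, h2, h3, h4, h5⟩ := h
  exact ⟨Q, h1, h2, h3, h5, h4⟩

lemma Config.swap_ya (h : Config K g x y a b c d a₁ a₂ b₁ b₂ sya syb sab) :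
    Config K g x a y b a₁ a₂ c d b₂ b₁ sya sab syb where
  nx := h.nx.swap₁₂
  ny := h.na
  na := h.ny
  nb := h.nb.swap₂₃
  cya := h.cya
  cyb := h.cab
  cab := h.cyb
  mya := by have := h.mya; tauto
  myb := by have := h.mab; tauto
  mab := by have := h.myb; tauto

lemma Config.swap_ab (h : Config K g x y a b c d a₁ a₂ b₁ b₂ sya syb sab) :
    Config K g x y b a d c b₁ b₂ a₁ a₂ syb sya sab where
  nx := h.nx.swap₂₃
  ny := h.ny.swap₂₃
  na := h.nb
  nb := h.na
  cya := h.cyb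
  cyb := h.cya
  cab := h.cab
  mya := by have := h.myb; tauto
  myb := by have := h.mya; tauto
  mab := by have := h.mab; tauto

lemma Config.cycles_ne (h : Config K g x y a b c d a₁ a₂ b₁ b₂ sya syb sab) :
    sya ≠ syb ∧ sya ≠ sab ∧ syb ≠ sab := by
  refine ⟨?_, ?_, ?_⟩ <;> rintro rfl
  exacts [h.myb.2.2.2.1 h.mya.2.2.1, h.mab.2.2.2.1 h.mya.2.1, h.mab.2.2.2.1 h.myb.2.1]

lemma IsGCycle.of_pathSet_erase_erase {s : Finset V} [DecidableEq V]
    (hP : PathSet K ((s.erase x).erase y) u v)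
    (hx : x ∈ s) (hy : y ∈ s) (hxy : K.Adj x y) (hxv : K.Adj x v) (hyu : K.Adj y u)
    (hcard : s.card = g) : IsGCycle K g s := by
  have h1 := Finset.card_erase_erase_add_two hx hy hxy.ne
  have h2 := Finset.insert_insert_erase_erase hx hy hxy.ne
  rw [← h2]
  exact hP.isGCycle_insert_insert (by simp) (by simp) hyu hxv hxy.symm (by omega)

variable [Fintype V] [DecidableEq V] {Good : SimpleGraph V → Prop}

/-- The flip at the edge `xy`, in which the two cycles through this edge survive. -/
lemma Config.exists_flip_edge (hW : GirthClass Good g) (hK : Good K)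
    (h : Config K g x y a b c d a₁ a₂ b₁ b₂ sya syb sab) :
    ∃ K', Good K' ∧ AgreeOff K K' x y ∧ Nbrs K' x y a d ∧ Nbrs K' y x c b ∧
      IsGCycle K' g sya ∧ IsGCycle K' g syb := by
  obtain ⟨x1, y1, a1, b1, c1, d1, -⟩ := h.mya
  obtain ⟨x2, y2, b2, a2, d2, c2, -⟩ := h.myb
  have hxy := h.nx.adj₁.ne
  have hS := h.cya.pathSet_erase_erase h.nx h.ny y1 a1 b1 d1
    (hW.ne_of_adj hK h.nx.adj₁ h.nx.adj₂ h.ny.adj₂)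
  have hT := h.cyb.pathSet_erase_erase h.nx.swap₂₃ h.ny.swap₂₃ y2 b2 a2 c2
    (hW.ne_of_adj hK h.nx.adj₁ h.nx.adj₃ h.ny.adj₃)
  have hcS := Finset.card_erase_erase_add_two x1 y1 hxy
  have := h.cya.1
  have := hW.five_le
  obtain ⟨K', hK', hag, hx', hy'⟩ := hW.flip_exchange hK h.nx h.ny (Or.inl ⟨rfl, rfl⟩) hxy hS.symm
    (by simp) (by simp) (by omega)
  refine ⟨K', hK', hag, hx', hy', ?_, ?_⟩
  · exact IsGCycle.of_pathSet_erase_erase (hS.of_agreeOff hag (by simp) (by simp)) x1 y1 hx'.adj₁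
      hx'.adj₂ hy'.adj₂ h.cya.1
  · exact IsGCycle.of_pathSet_erase_erase (hT.symm.of_agreeOff hag (by simp) (by simp)) x2 y2
      hx'.adj₁ hx'.adj₃ hy'.adj₃ h.cyb.1

omit [DecidableEq V] in
lemma Config.ne (hW : GirthClass Good g) (hK : Good K)
    (h : Config K g x y a b c d a₁ a₂ b₁ b₂ sya syb sab) :
    a₁ ≠ y ∧ a₂ ≠ y ∧ b₁ ≠ y ∧ b₂ ≠ y ∧ c ≠ a ∧ d ≠ a ∧ c ≠ b ∧ d ≠ b := by
  have hx := h.nx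
  have hy := h.ny
  have ha := h.na
  have hb := h.nb
  exact ⟨hW.ne_of_adj hK hx.adj₂.symm ha.adj₂ hx.adj₁, hW.ne_of_adj hK hx.adj₂.symm ha.adj₃ hx.adj₁,
    hW.ne_of_adj hK hx.adj₃.symm hb.adj₂ hx.adj₁, hW.ne_of_adj hK hx.adj₃.symm hb.adj₃ hx.adj₁,
    hW.ne_of_adj hK hx.adj₁.symm hy.adj₂ hx.adj₂, hW.ne_of_adj hK hx.adj₁.symm hy.adj₃ hx.adj₂,
    hW.ne_of_adj hK hx.adj₁.symm hy.adj₂ hx.adj₃, hW.ne_of_adj hK hx.adj₁.symm hy.adj₃ hx.adj₃⟩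

lemma Config.core_or_core (hW : GirthClass Good g) (hK : Good K)
    (h : Config K g x y a b c d a₁ a₂ b₁ b₂ sya syb sab) :
    Core K g x y a d a₂ ∨ Core K g x y b c b₂ := by
  obtain ⟨K', hK', hag, hx', hy', hya, hyb⟩ := h.exists_flip_edge hW hK
  have hg' := hW.largeGirth hK'
  obtain ⟨x1, y1, a1, b1, c1, d1, f1, e1⟩ := h.mya
  obtain ⟨x2, y2, b2, a2, d2, c2, f2, e2⟩ := h.myb
  obtain ⟨x3, a3, b3, y3, -⟩ := h.mab
  obtain ⟨n1, n2, n3, n4, n5, n6, n7, n8⟩ := h.ne hW hK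
  obtain ⟨ne1, ne2, ne3⟩ := h.cycles_ne
  obtain ⟨s, hs, hsxy, hnew⟩ := hW.exists_notMem hK hK' hag (A := {sya, syb, sab})
    (B := {sya, syb}) (by
      simp only [Finset.mem_insert, Finset.mem_singleton]
      rintro s (rfl | rfl | rfl)
      exacts [⟨h.cya, Or.inl x1⟩, ⟨h.cyb, Or.inl x2⟩, ⟨h.cab, Or.inl x3⟩]) (by
      rw [Finset.card_eq_three.2 ⟨_, _, _, ne1, ne2, ne3, rfl⟩, Finset.card_pair ne1]
      omega)
  simp only [Finset.mem_insert, Finset.mem_singleton, not_or] at hnew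
  have hsc := hs.1
  have hax := h.nx.adj₂.ne'
  have hbx := h.nx.adj₃.ne'
  have hay := h.nx.1.symm
  have hby := h.nx.2.1.symm
  by_cases hsx : x ∈ s ∧ y ∉ s
  · left
    obtain ⟨hsx, hsy⟩ := hsx
    have ha' := hW.nbrs_of_adj hK' hx'.adj₂.symm
      ((hag a a₁ hax hay h.na.1.symm n1).1 h.na.adj₂)
      ((hag a a₂ hax hay h.na.2.1.symm n2).1 h.na.adj₃) h.na.1 h.na.2.1 h.na.2.2.1
    obtain ⟨hsd, hsa⟩ := hs.mem_of_notMem hg' hx'.swap₁₃ hsx hsy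
    have hsa1 : a₁ ∉ s := fun hh => hnew.1
      (hW.eq_of_mem hK' hs hya hx'.adj₂.symm ha'.adj₂ h.na.1 hsa hsx hh a1 x1 f1)
    have hP := hs.pathSet_erase_erase hx'.swap₁₂.swap₂₃ ha'.swap₂₃ hsa hsd hsy hsa1
      (hW.ne_of_adj hK' hx'.adj₂ hx'.adj₃ ha'.adj₃)
    have hcard := Finset.card_erase_erase_add_two hsx hsa hax.symm
    exact ⟨_, by omega, hP.symm.of_agreeOff hag.symm (by simp) (by simp [hsy]), by simp,
      by simp [hsy], by simp⟩
  · right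
    have hsx' : x ∉ s := by
      intro hh
      rcases hs.mem_cases hg' hh hx' with hm | hm | hm
      · exact hnew.1 (hW.eq_of_mem hK' hs hya hx'.adj₁ hx'.adj₂ hx'.1 hh hm.1 hm.2.1 x1 y1 a1)
      · exact hnew.2 (hW.eq_of_mem hK' hs hyb hx'.adj₁ hx'.adj₃ hx'.2.1 hh hm.1 hm.2.2 x2 y2 d2)
      · exact hsx ⟨hh, hm.1⟩
    have hsy := hsxy.resolve_left hsx'
    have hb' := hW.nbrs_of_adj hK' hy'.adj₃.symm
      ((hag b b₁ hbx hby h.nb.1.symm n3).1 h.nb.adj₂)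
      ((hag b b₂ hbx hby h.nb.2.1.symm n4).1 h.nb.adj₃) n3.symm n4.symm h.nb.2.2.1
    obtain ⟨hsb, hsc'⟩ := hs.mem_of_notMem hg' hy'.swap₁₃ hsy hsx'
    have hsb1 : b₁ ∉ s := fun hh => hnew.2
      (hW.eq_of_mem hK' hs hyb hy'.adj₃.symm hb'.adj₂ n3.symm hsb hsy hh b2 y2 f2)
    have hP := hs.pathSet_erase_erase hy'.swap₁₃ hb'.swap₂₃ hsb hsc' hsx' hsb1
      (hW.ne_of_adj hK' hy'.adj₃ hy'.adj₂ hb'.adj₃)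
    have hcard := Finset.card_erase_erase_add_two hsy hsb hby.symm
    exact ⟨_, by omega, hP.symm.of_agreeOff hag.symm (by simp [hsx']) (by simp), by simp [hsx'],
      by simp, by simp⟩

end Config

section Contradiction

variable {V : Type*} [Fintype V] [DecidableEq V] {Good : SimpleGraph V → Prop}
  {K : SimpleGraph V} {g : ℕ} {x y a b c d a₁ a₂ b₁ b₂ u v e : V} {sya syb sab P Z : Finset V}

lemma Finset.card_eq_four_of_ne {α : Type*} [DecidableEq α] {p q r s : α} (h1 : p ≠ q)
    (h2 : p ≠ r) (h3 : p ≠ s) (h4 : q ≠ r) (h5 : q ≠ s) (h6 : r ≠ s) :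
    ({p, q, r, s} : Finset α).card = 4 := by
  rw [Finset.card_insert_of_notMem (by simp [h1, h2, h3]),
    Finset.card_eq_three.2 ⟨_, _, _, h4, h5, h6, rfl⟩]

/-- The `g`-cycles through `x` are the three given ones. -/
lemma Config.eq_of_mem (hW : GirthClass Good g) (hK : Good K)
    (h : Config K g x y a b c d a₁ a₂ b₁ b₂ sya syb sab) (hs : IsGCycle K g Z) (hx : x ∈ Z) :
    Z = sya ∨ Z = syb ∨ Z = sab := by
  obtain ⟨x1, y1, a1, -⟩ := h.mya
  obtain ⟨x2, y2, b2, -⟩ := h.myb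
  obtain ⟨x3, a3, b3, -⟩ := h.mab
  obtain ⟨n1, n2, n3, -⟩ := id h.nx
  rcases hs.mem_cases (hW.largeGirth hK) hx h.nx with hm | hm | hm
  · exact Or.inl (hW.eq_of_mem hK hs h.cya h.nx.adj₁ h.nx.adj₂ n1 hx hm.1 hm.2.1 x1 y1 a1)
  · exact Or.inr (Or.inl
      (hW.eq_of_mem hK hs h.cyb h.nx.adj₁ h.nx.adj₃ n2 hx hm.1 hm.2.2 x2 y2 b2))
  · exact Or.inr (Or.inr
      (hW.eq_of_mem hK hs h.cab h.nx.adj₂ h.nx.adj₃ n3 hx hm.2.1 hm.2.2 x3 a3 b3))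

lemma Config.exists_fourth (hW : GirthClass Good g) (hK : Good K)
    (h : Config K g x y a b c d a₁ a₂ b₁ b₂ sya syb sab) (h1 : Core K g x y a d a₂)
    (h2 : Core K g x y b c b₂) :
    ∃ s, IsGCycle K g s ∧ x ∉ s ∧ y ∈ s := by
  obtain ⟨K', hK', hag, hx', hy', hya, hyb⟩ := h.exists_flip_edge hW hK
  obtain ⟨P, hcP, hP, xP, yP, aP⟩ := h1
  obtain ⟨Q, hcQ, hQ, xQ, yQ, bQ⟩ := h2
  obtain ⟨x1, y1, a1, -⟩ := h.mya
  obtain ⟨x2, y2, b2, -⟩ := h.myb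
  obtain ⟨x3, a3, b3, -⟩ := h.mab
  obtain ⟨n1, n2, n3, n4, n5, n6, n7, n8⟩ := h.ne hW hK
  obtain ⟨ne1, ne2, ne3⟩ := h.cycles_ne
  have hax := h.nx.adj₂.ne'
  have hbx := h.nx.adj₃.ne'
  have hay := h.nx.1.symm
  have hby := h.nx.2.1.symm
  have hcP' := (hP.of_agreeOff hag xP yP).isGCycle_insert_insert xP aP hx'.adj₃
    ((hag a a₂ hax hay h.na.2.1.symm n2).1 h.na.adj₃) hx'.adj₂ hcP
  have hcQ' := (hQ.of_agreeOff hag xQ yQ).isGCycle_insert_insert yQ bQ hy'.adj₂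
    ((hag b b₂ hbx hby h.nb.2.1.symm n4).1 h.nb.adj₃) hy'.adj₃ hcQ
  have hyP : y ∉ insert a (insert x P) := by simp [hay.symm, h.nx.adj₁.ne', yP]
  have hxQ : x ∉ insert b (insert y Q) := by simp [hbx.symm, h.nx.adj₁.ne, xQ]
  obtain ⟨s, hs, hsxy, hnew⟩ := hW.exists_notMem hK' hK hag.symm
    (A := {sya, syb, insert a (insert x P), insert b (insert y Q)}) (B := {sya, syb, sab}) (by
      simp only [Finset.mem_insert, Finset.mem_singleton]
      rintro s (rfl | rfl | rfl | rfl)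
      exacts [⟨hya, Or.inl x1⟩, ⟨hyb, Or.inl x2⟩, ⟨hcP', by simp⟩, ⟨hcQ', by simp⟩]) (by
      rw [Finset.card_eq_three.2 ⟨_, _, _, ne1, ne2, ne3, rfl⟩, Finset.card_eq_four_of_ne ne1]
      · omega
      · rintro rfl; exact hyP y1
      · rintro rfl; exact hxQ x1
      · rintro rfl; exact hyP y2
      · rintro rfl; exact hxQ x2
      · intro heq; rw [heq] at hyP; simp at hyP)
  simp only [Finset.mem_insert, Finset.mem_singleton, not_or] at hnew
  have hx : x ∉ s := fun hx => by
    have := h.eq_of_mem hW hK hs hx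
    tauto
  exact ⟨s, hs, hx, hsxy.resolve_left hx⟩

/-- The path from `c` to `a₁` left from the cycle `sya` by deleting `y`, `x` and `a`. -/
lemma Config.pathSet_three (hW : GirthClass Good g) (hK : Good K)
    (h : Config K g x y a b c d a₁ a₂ b₁ b₂ sya syb sab) :
    PathSet K (((sya.erase x).erase y).erase a) c a₁ ∧
      (((sya.erase x).erase y).erase a).card + 3 = g := by
  obtain ⟨x1, y1, a1, b1, c1, d1, f1, e1⟩ := h.mya
  have hac := hW.ne_of_adj hK h.nx.adj₁ h.nx.adj₂ h.ny.adj₂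
  have hS := h.cya.pathSet_erase_erase h.nx h.ny y1 a1 b1 d1 hac
  have hca1 : c ≠ a₁ := by
    rintro rfl
    exact h.ny.1 (hW.eq_of_adj hK h.nx.1 h.nx.adj₁.symm h.nx.adj₂.symm h.ny.adj₂ h.na.adj₂)
  refine ⟨(hS.symm.erase_of_nbrs h.na (by simp) (by simp [e1]) hca1.symm).symm, ?_⟩
  have hcS := Finset.card_erase_erase_add_two x1 y1 h.nx.adj₁.ne
  have := Finset.card_erase_add_one (s := (sya.erase x).erase y) (a := a)
    (by simp [a1, h.nx.1.symm, h.nx.adj₂.ne'])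
  have := h.cya.1
  omega

/-- The flip at the two neighbours `y` and `a` of `x`. -/
lemma Config.exists_flip_common (hW : GirthClass Good g) (hK : Good K)
    (h : Config K g x y a b c d a₁ a₂ b₁ b₂ sya syb sab) :
    ∃ K', Good K' ∧ AgreeOff K K' y a ∧ Nbrs K' y x c a₂ ∧ Nbrs K' a x a₁ d ∧ K'.Adj x b ∧
      IsGCycle K' g sya ∧ PathSet K' ((sab.erase x).erase a) a₂ b ∧
      PathSet K' ((syb.erase x).erase y) d b := by
  obtain ⟨hQ, hcQ⟩ := h.pathSet_three hW hK
  obtain ⟨x1, y1, a1, b1, c1, d1, f1, e1⟩ := h.mya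
  obtain ⟨x2, y2, b2, a2, d2, c2, f2, e2⟩ := h.myb
  obtain ⟨x3, a3, b3, y3, g3, -⟩ := h.mab
  obtain ⟨K', hK', hag, hy', ha'⟩ := hW.flip_exchange hK h.ny h.na (Or.inr rfl) h.nx.1 hQ
    (by simp) (by simp) (by omega)
  refine ⟨K', hK', hag, hy', ha', ?_, ?_, ?_, ?_⟩
  · exact (hag x b h.nx.adj₁.ne h.nx.adj₂.ne h.nx.2.1.symm h.nx.2.2.1.symm).1 h.nx.adj₃
  · have h1 := (hQ.of_agreeOff hag (by simp) (by simp)).insert_adj (v := y) (by simp) hy'.adj₂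
    rw [Finset.erase_right_comm, Finset.insert_erase (by simp [y1, h.nx.1, h.nx.adj₁.ne'])] at h1
    have h2 := h1.symm.insert_adj (v := a) (by simp) ha'.adj₂
    rw [Finset.insert_erase (by simp [a1, h.nx.adj₂.ne'])] at h2
    have h3 := h2.minTwo_insert (v := x) (by simp) ha'.adj₁.symm hy'.adj₁.symm
    rw [Finset.insert_erase x1] at h3
    exact ⟨h.cya.1, h3⟩
  · exact (h.cab.pathSet_erase_erase h.nx.swap₁₂.swap₂₃ h.na.swap₂₃ a3 b3 y3 h.mab.2.2.2.2.2.1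
      (hW.ne_of_adj hK h.nx.adj₂ h.nx.adj₃ h.na.adj₃)).of_agreeOff hag (by simp [y3]) (by simp)
  · exact (h.cyb.pathSet_erase_erase h.nx.swap₂₃ h.ny.swap₂₃ y2 b2 a2 c2
      (hW.ne_of_adj hK h.nx.adj₁ h.nx.adj₃ h.ny.adj₃)).of_agreeOff hag (by simp) (by simp [a2])

lemma Config.exists_pathSet (hW : GirthClass Good g) (hK : Good K)
    (h : Config K g x y a b c d a₁ a₂ b₁ b₂ sya syb sab) {s : Finset V} (hs : IsGCycle K g s)
    (hxs : x ∉ s) (hys : y ∈ s) :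
    ∃ Z : Finset V, Z.card + 1 = g ∧ x ∉ Z ∧ y ∉ Z ∧ a ∉ Z ∧
      (PathSet K Z c a₂ ∨ PathSet K Z a₁ d) := by
  obtain ⟨K', hK', hag, hy', ha', hxb, hya, hS, hT⟩ := h.exists_flip_common hW hK
  have hg' := hW.largeGirth hK'
  obtain ⟨x1, y1, a1, b1, c1, d1, f1, e1⟩ := h.mya
  obtain ⟨x2, y2, b2, a2, d2, c2, f2, e2⟩ := h.myb
  obtain ⟨x3, a3, b3, y3, g3, -⟩ := h.mab
  obtain ⟨ne1, ne2, ne3⟩ := h.cycles_ne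
  have hx' := hW.nbrs_of_adj hK' hy'.adj₁.symm ha'.adj₁.symm hxb h.nx.1 h.nx.2.1 h.nx.2.2.1
  have hcS := Finset.card_erase_erase_add_two x3 a3 hx'.adj₂.ne
  have hcT := Finset.card_erase_erase_add_two x2 y2 hx'.adj₁.ne
  rw [h.cab.1] at hcS
  rw [h.cyb.1] at hcT
  have hS' := hS.isGCycle_insert_insert (v := y) (w := x) (by simp [y3]) (by simp) hy'.adj₃ hxb
    hy'.adj₁ hcS
  have hT' := hT.isGCycle_insert_insert (v := a) (w := x) (by simp [a2]) (by simp) ha'.adj₃ hxb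
    ha'.adj₁ hcT
  set S := insert x (insert y ((sab.erase x).erase a)) with hSdef
  set T := insert x (insert a ((syb.erase x).erase y)) with hTdef
  obtain ⟨w, hw, hwya, hnew⟩ := hW.exists_notMem hK hK' hag
    (A := {sya, syb, sab, s}) (B := {sya, S, T}) (by
      simp only [Finset.mem_insert, Finset.mem_singleton]
      rintro s (rfl | rfl | rfl | rfl)
      exacts [⟨h.cya, Or.inl y1⟩, ⟨h.cyb, Or.inl y2⟩, ⟨h.cab, Or.inr a3⟩, ⟨hs, Or.inl hys⟩]) (by
      rw [Finset.card_eq_four_of_ne ne1 ne2 _ ne3]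
      · exact lt_of_le_of_lt Finset.card_le_three (by omega)
      · rintro rfl; exact hxs x2
      · rintro rfl; exact hxs x3
      · rintro rfl; exact hxs x1)
  simp only [Finset.mem_insert, Finset.mem_singleton, not_or] at hnew
  have hxw : x ∉ w := by
    intro hx
    rcases hw.mem_cases hg' hx hx' with hm | hm | hm
    · exact hnew.1 (hW.eq_of_mem hK' hw hya hx'.adj₁ hx'.adj₂ hx'.1 hx hm.1 hm.2.1 x1 y1 a1)
    · exact hnew.2.1 (hW.eq_of_mem hK' hw hS' hx'.adj₁ hx'.adj₃ hx'.2.1 hx hm.1 hm.2.2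
        (by simp [hSdef]) (by simp [hSdef]) (by simp [hSdef, b3, hx'.2.2.1.symm, hx'.adj₃.ne']))
    · exact hnew.2.2 (hW.eq_of_mem hK' hw hT' hx'.adj₂ hx'.adj₃ hx'.2.2.1 hx hm.2.1 hm.2.2
        (by simp [hTdef]) (by simp [hTdef]) (by simp [hTdef, b2, hx'.2.1.symm, hx'.adj₃.ne']))
  have hyaw : ¬ (y ∈ w ∧ a ∈ w) := fun hh =>
    hx'.1 (hw.eq_of_adj hW.five_le hg' hxw hh.1 hh.2 hx'.adj₁ hx'.adj₂)
  have hwc := hw.1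
  refine hwya.elim (fun hyw => ⟨w.erase y, ?_⟩) (fun haw => ⟨w.erase a, ?_⟩)
  · have haw : a ∉ w := fun haw => hyaw ⟨hyw, haw⟩
    have h1 := hw.mem_of_notMem hg' hy'.swap₁₃ hyw hxw
    have h2 := Finset.card_erase_add_one hyw
    refine ⟨by omega, by simp [hxw], by simp, by simp [haw], Or.inl ?_⟩
    exact (hw.pathSet_erase hy'.swap₁₃ h1.1 h1.2 hxw).symm.of_agreeOff hag.symm (by simp)
      (by simp [haw])
  · have hyw : y ∉ w := fun hyw => hyaw ⟨hyw, haw⟩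
    have h1 := hw.mem_of_notMem hg' ha'.swap₁₃ haw hxw
    have h2 := Finset.card_erase_add_one haw
    refine ⟨by omega, by simp [hxw], by simp [hyw], by simp, Or.inr ?_⟩
    exact (hw.pathSet_erase ha'.swap₁₃ h1.1 h1.2 hxw).symm.of_agreeOff hag.symm (by simp [hyw])
      (by simp)

end Contradiction

section Contradiction

variable {V : Type*} [Fintype V] [DecidableEq V] {Good : SimpleGraph V → Prop}
  {K : SimpleGraph V} {g : ℕ} {x y a b c d a₁ a₂ b₁ b₂ u v e : V} {sya syb sab P Z : Finset V}

lemma Config.not_mem_of_pathSet (hW : GirthClass Good g) (hK : Good K)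
    (h : Config K g x y a b c d a₁ a₂ b₁ b₂ sya syb sab) (hZ : PathSet K Z c a₂)
    (hcZ : Z.card + 1 = g) (hxZ : x ∉ Z) (hyZ : y ∉ Z) (haZ : a ∉ Z) (he : K.Adj a₂ e)
    (heZ : e ∈ Z) : e ∉ (sab.erase x).erase a := by
  intro heS
  obtain ⟨K', hK', hag, hy', ha', hxb, -, hS, -⟩ := h.exists_flip_common hW hK
  obtain ⟨x3, a3, b3, y3, g3, -⟩ := h.mab
  have hcS := Finset.card_erase_erase_add_two x3 a3 h.nx.adj₂.ne
  rw [h.cab.1] at hcS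
  have hS' := hS.isGCycle_insert_insert (v := y) (w := x) (by simp [y3]) (by simp) hy'.adj₃ hxb
    hy'.adj₁ hcS
  have hZ' := (hZ.of_agreeOff hag hyZ haZ).isGCycle_insert hyZ hy'.adj₂ hy'.adj₃ hcZ
  have ha₂ := hZ.2.1
  have hne : ∀ t ∈ Z, t ≠ y ∧ t ≠ a := fun t ht =>
    ⟨by rintro rfl; exact hyZ ht, by rintro rfl; exact haZ ht⟩
  have he' := (hag a₂ e (hne _ ha₂).1 (hne _ ha₂).2 (hne _ heZ).1 (hne _ heZ).2).1 he
  have heq := hW.eq_of_mem hK' hZ' hS' hy'.adj₃.symm he' (hne e heZ).1.symm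
    (by simp [ha₂]) (by simp) (by simp [heZ])
    (Finset.mem_insert_of_mem (Finset.mem_insert_of_mem hS.1)) (by simp)
    (Finset.mem_insert_of_mem (Finset.mem_insert_of_mem heS))
  have hx : x ∈ insert y Z := by rw [heq]; simp
  exact (Finset.mem_insert.1 hx).elim h.nx.adj₁.ne hxZ

lemma Config.not_mem_of_core (hW : GirthClass Good g) (hK : Good K)
    (h : Config K g x y a b c d a₁ a₂ b₁ b₂ sya syb sab) (hP : PathSet K P d a₂)
    (hcP : P.card + 2 = g) (hxP : x ∉ P) (hyP : y ∉ P) (haP : a ∉ P) (he : K.Adj a₂ e)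
    (heP : e ∈ P) : e ∉ (sab.erase x).erase a := by
  intro heS
  have hg := hW.largeGirth hK
  obtain ⟨x1, y1, a1, b1, c1, d1, f1, e1⟩ := h.mya
  obtain ⟨x3, a3, b3, y3, g3, f3, -⟩ := h.mab
  obtain ⟨n1, n2, n3, n4, n5, n6, n7, n8⟩ := h.ne hW hK
  have hnx := h.nx.swap₁₂
  have hxa := hnx.adj₁.ne
  have hQ := h.cya.pathSet_erase_erase hnx h.na a1 y1 b1 e1 n1.symm
  have hcQ := Finset.card_erase_erase_add_two x1 a1 hxa
  have hcS := Finset.card_erase_erase_add_two x3 a3 hxa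
  rw [h.cya.1] at hcQ
  rw [h.cab.1] at hcS
  obtain ⟨K', hK', hag, hx', ha'⟩ := hW.flip_exchange hK hnx h.na (Or.inl ⟨rfl, rfl⟩) hxa hQ.symm
    (by simp) (by simp) (by omega)
  have hS := (h.cab.pathSet_erase_erase hnx.swap₂₃ h.na.swap₂₃ a3 b3 y3 f3
    (hW.ne_of_adj hK hnx.adj₁ hnx.adj₃ h.na.adj₃)).of_agreeOff hag (by simp) (by simp)
  have hS' := hS.isGCycle_insert_insert (v := x) (w := a) (by simp) (by simp) hx'.adj₃ ha'.adj₃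
    hx'.adj₁ hcS
  have hyd := (hag y d h.nx.adj₁.ne' h.nx.1 h.ny.2.1.symm n6).1 h.ny.adj₃
  have hP' := (hP.of_agreeOff hag hxP haP).isGCycle_insert_insert (v := y) (w := x) hyP hxP hyd
    hx'.adj₃ hx'.adj₂.symm hcP
  have ha₂ := hP.2.1
  have hne : ∀ t ∈ P, t ≠ x ∧ t ≠ a := fun t ht =>
    ⟨by rintro rfl; exact hxP ht, by rintro rfl; exact haP ht⟩
  have he' := (hag a₂ e (hne _ ha₂).1 (hne _ ha₂).2 (hne _ heP).1 (hne _ heP).2).1 he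
  have heq := hW.eq_of_mem hK' hP' hS' hx'.adj₃.symm he' (hne e heP).1.symm
    (by simp [ha₂]) (by simp) (by simp [heP])
    (Finset.mem_insert_of_mem (Finset.mem_insert_of_mem hS.1)) (by simp)
    (Finset.mem_insert_of_mem (Finset.mem_insert_of_mem heS))
  have ha : a ∈ insert x (insert y P) := by rw [heq]; simp
  simp [hxa.symm, h.nx.1.symm, haP] at ha

lemma Config.not_mem_of_core_of_pathSet (hW : GirthClass Good g) (hK : Good K)
    (h : Config K g x y a b c d a₁ a₂ b₁ b₂ sya syb sab) (hP : PathSet K P d a₂)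
    (hcP : P.card + 2 = g) (hxP : x ∉ P) (hyP : y ∉ P) (haP : a ∉ P) (hZ : PathSet K Z c a₂)
    (hcZ : Z.card + 1 = g) (hxZ : x ∉ Z) (hyZ : y ∉ Z) (haZ : a ∉ Z) (he : K.Adj a₂ e)
    (heP : e ∈ P) : e ∉ Z := by
  intro heZ
  obtain ⟨n1, n2, n3, n4, n5, n6, n7, n8⟩ := h.ne hW hK
  obtain ⟨hQ, hcQ⟩ := h.pathSet_three hW hK
  obtain ⟨K', hK', hag, hx', hy', -, -⟩ := h.exists_flip_edge hW hK
  have hax := h.nx.adj₂.ne'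
  have hay := h.nx.1.symm
  have ha' := hW.nbrs_of_adj hK' hx'.adj₂.symm
    ((hag a a₁ hax hay h.na.1.symm n1).1 h.na.adj₂)
    ((hag a a₂ hax hay h.na.2.1.symm n2).1 h.na.adj₃) h.na.1 h.na.2.1 h.na.2.2.1
  have hQ' := hQ.of_agreeOff hag (by simp) (by simp)
  obtain ⟨L, hL, hag', hyL, haL⟩ := hW.flip_exchange hK' hy' ha' (Or.inr rfl) h.nx.1 hQ'
    (by simp) (by simp) (by omega)
  have hxd := (hag' x d h.nx.adj₁.ne h.nx.adj₂.ne h.ny.adj₃.ne' n6).1 hx'.adj₃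
  have hP' := ((hP.of_agreeOff hag hxP hyP).of_agreeOff hag' hyP haP).isGCycle_insert_insert
    (v := x) (w := y) hxP hyP hxd hyL.adj₃ hyL.adj₁.symm hcP
  have hZ' := ((hZ.of_agreeOff hag hxZ hyZ).of_agreeOff hag' hyZ haZ).isGCycle_insert
    hyZ hyL.adj₂ hyL.adj₃ hcZ
  have ha₂ := hP.2.1
  have hne : ∀ t ∈ P, t ≠ x ∧ t ≠ y ∧ t ≠ a := fun t ht =>
    ⟨by rintro rfl; exact hxP ht, by rintro rfl; exact hyP ht, by rintro rfl; exact haP ht⟩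
  obtain ⟨p1, p2, p3⟩ := hne _ ha₂
  obtain ⟨q1, q2, q3⟩ := hne _ heP
  have he' := (hag' a₂ e p2 p3 q2 q3).1 ((hag a₂ e p1 p2 q1 q2).1 he)
  have heq := hW.eq_of_mem hL hZ' hP' hyL.adj₃.symm he' q2.symm
    (by simp [hZ.2.1]) (by simp) (by simp [heZ]) (by simp [ha₂]) (by simp) (by simp [heP])
  have hx : x ∈ insert y Z := by rw [heq]; simp
  exact (Finset.mem_insert.1 hx).elim h.nx.adj₁.ne hxZ

lemma Config.false_of_pathSet (hW : GirthClass Good g) (hK : Good K)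
    (h : Config K g x y a b c d a₁ a₂ b₁ b₂ sya syb sab) (hP : Core K g x y a d a₂)
    (hZ : PathSet K Z c a₂) (hcZ : Z.card + 1 = g) (hxZ : x ∉ Z) (hyZ : y ∉ Z) (haZ : a ∉ Z) :
    False := by
  obtain ⟨P, hcP, hP, hxP, hyP, haP⟩ := hP
  obtain ⟨x3, a3, b3, y3, g3, f3, -⟩ := h.mab
  have hS := h.cab.pathSet_erase_erase h.nx.swap₁₂.swap₂₃ h.na.swap₂₃ a3 b3 y3 f3
    (hW.ne_of_adj hK h.nx.adj₂ h.nx.adj₃ h.na.adj₃)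
  obtain ⟨_, _, _, hn⟩ := hW.nbrs hK a₂
  obtain ⟨e, f, hn⟩ := hn.exists_of_adj h.na.adj₃.symm
  have key : ∀ Q : Finset V, a ∉ Q → (∃ t ∈ Q, K.Adj a₂ t) → e ∈ Q ∨ f ∈ Q := by
    rintro Q haQ ⟨t, ht, hat⟩
    rcases (hn.2.2.2 t).1 hat with rfl | rfl | rfl
    exacts [absurd ht haQ, Or.inl ht, Or.inr ht]
  have hpair : ∀ t, K.Adj a₂ t → (t ∈ Z → t ∉ (sab.erase x).erase a) ∧
      (t ∈ P → t ∉ (sab.erase x).erase a) ∧ (t ∈ P → t ∉ Z) := fun t ht =>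
    ⟨h.not_mem_of_pathSet hW hK hZ hcZ hxZ hyZ haZ ht,
      h.not_mem_of_core hW hK hP hcP hxP hyP haP ht,
      h.not_mem_of_core_of_pathSet hW hK hP hcP hxP hyP haP hZ hcZ hxZ hyZ haZ ht⟩
  have he := hpair e hn.adj₂
  have hf := hpair f hn.adj₃
  have h1 := key Z haZ hZ.2.2.2.2.1
  have h2 := key P haP hP.2.2.2.2.1
  have h3 := key ((sab.erase x).erase a) (by simp) hS.2.2.2.1
  rcases h1 with z | z <;> rcases h2 with p | p <;> rcases h3 with q | q
  exacts [he.2.2 p z, he.2.2 p z, he.1 z q, hf.2.1 p q, he.2.1 p q, hf.1 z q, hf.2.2 p z,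
    hf.2.2 p z]

lemma Config.not_core_and_core (hW : GirthClass Good g) (hK : Good K)
    (h : Config K g x y a b c d a₁ a₂ b₁ b₂ sya syb sab) :
    ¬ (Core K g x y a d a₂ ∧ Core K g x y b c b₂) := by
  rintro ⟨h1, h2⟩
  obtain ⟨s, hs, hxs, hys⟩ := h.exists_fourth hW hK h1 h2
  obtain ⟨Z, hcZ, hxZ, hyZ, haZ, hZ | hZ⟩ := h.exists_pathSet hW hK hs hxs hys
  · exact h.false_of_pathSet hW hK h1 hZ hcZ hxZ hyZ haZ
  · exact h.swap_ya.false_of_pathSet hW hK h1.symm.swap hZ hcZ hxZ haZ hyZ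

lemma Config.false (hW : GirthClass Good g) (hK : Good K)
    (h : Config K g x y a b c d a₁ a₂ b₁ b₂ sya syb sab) : False := by
  have h1 := h.core_or_core hW hK
  have h2 := h.swap_ya.core_or_core hW hK
  have h3 := h.swap_ab.swap_ya.core_or_core hW hK
  have n1 := h.not_core_and_core hW hK
  have n2 := h.swap_ya.not_core_and_core hW hK
  have n3 := h.swap_ab.swap_ya.not_core_and_core hW hK
  rcases h1 with hya | hyb
  · rcases h3 with hyb | hab
    exacts [n1 ⟨hya, hyb.symm.swap⟩, n2 ⟨hya.symm.swap, hab.symm.swap⟩]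
  · rcases h2 with hya | hab
    exacts [n1 ⟨hya.symm.swap, hyb⟩, n3 ⟨hyb.symm.swap, hab.symm.swap⟩]

omit [Fintype V] in
lemma IsGCycle.exists_nbrs_order {s : Finset V} (hs : IsGCycle K g s) (hK : LargeGirth K g)
    (hv : v ∈ s) (h : Nbrs K v x u e) (hx : x ∈ s) :
    ∃ p q, Nbrs K v x p q ∧ p ∈ s ∧ q ∉ s := by
  rcases hs.mem_cases hK hv h with hm | hm | hm
  exacts [⟨_, _, h, hm.2⟩, ⟨_, _, h.swap₂₃, hm.2.2, hm.2.1⟩, absurd hx hm.1]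

/-- No vertex lies in three distinct `g`-cycles. -/
lemma GirthClass.not_three (hW : GirthClass Good g) (hK : Good K) {r s t : Finset V}
    (hr : IsGCycle K g r) (hs : IsGCycle K g s) (ht : IsGCycle K g t) (hrs : r ≠ s) (hrt : r ≠ t)
    (hst : s ≠ t) (hxr : x ∈ r) (hxs : x ∈ s) (hxt : x ∈ t) : False := by
  have hg := hW.largeGirth hK
  obtain ⟨y, hyr, a, har, b, hbr, hx⟩ : ∃ y ∈ r, ∃ a ∈ r, ∃ b ∉ r, Nbrs K x y a b := by
    obtain ⟨p, q, l, h⟩ := hW.nbrs hK x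
    rcases hr.mem_cases hg hxr h with ⟨h1, h2, h3⟩ | ⟨h1, h2, h3⟩ | ⟨h1, h2, h3⟩
    exacts [⟨_, h1, _, h2, _, h3, h⟩, ⟨_, h1, _, h3, _, h2, h.swap₂₃⟩,
      ⟨_, h3, _, h2, _, h1, h.swap₁₃⟩]
  have hnew : ∀ {v} {s t : Finset V} {p q}, IsGCycle K g s → IsGCycle K g t → s ≠ t → v ∈ s →
      v ∈ t → K.Adj v p → K.Adj v q → p ≠ q → p ∈ s → q ∈ s → p ∈ t → q ∈ t → False :=
    fun hs ht hst hxs hxt hu hv huv h1 h2 h3 h4 =>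
      hst (hW.eq_of_mem hK hs ht hu hv huv hxs h1 h2 hxt h3 h4)
  have main : ∀ s t, IsGCycle K g s → IsGCycle K g t → r ≠ s → r ≠ t → s ≠ t → x ∈ s → x ∈ t →
      y ∈ s ∧ a ∉ s ∧ b ∈ s → y ∉ t ∧ a ∈ t ∧ b ∈ t → False := by
    intro s t hs ht hrs hrt hst hxs hxt ⟨hys, has, hbs⟩ ⟨hyt, hat, hbt⟩
    have other : ∀ {v} {s t : Finset V}, IsGCycle K g s → IsGCycle K g t → s ≠ t → x ∈ s →
        x ∈ t → v ∈ s → v ∈ t → K.Adj x v →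
        ∃ p q, Nbrs K v x p q ∧ (p ∈ s ∧ q ∉ s) ∧ q ∈ t ∧ p ∉ t := by
      intro v s t hs ht hst hxs hxt hvs hvt hxv
      obtain ⟨_, _, _, h⟩ := hW.nbrs hK v
      obtain ⟨_, _, h⟩ := h.exists_of_adj hxv.symm
      obtain ⟨p, q, h, hp, hq⟩ := hs.exists_nbrs_order hg hvs h hxs
      have hpt : p ∉ t := fun hpt =>
        hnew hs ht hst hvs hvt h.adj₁ h.adj₂ h.1 hxs hp hxt hpt
      exact ⟨p, q, h, ⟨hp, hq⟩, (ht.mem_of_notMem hg h.swap₂₃ hvt hpt).2, hpt⟩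
    obtain ⟨c, d, hy, hcd, hcd'⟩ := other hr hs hrs hxr hxs hyr hys hx.adj₁
    obtain ⟨a₁, a₂, ha, haa, haa'⟩ := other hr ht hrt hxr hxt har hat hx.adj₂
    obtain ⟨b₁, b₂, hb, hbb, hbb'⟩ := other hs ht hst hxs hxt hbs hbt hx.adj₃
    have h : Config K g x y a b c d a₁ a₂ b₁ b₂ r s t :=
      ⟨hx, hy, ha, hb, hr, hs, ht, ⟨hxr, hyr, har, hbr, hcd.1, hcd.2, haa⟩,
        ⟨hxs, hys, hbs, has, hcd'.1, hcd'.2, hbb⟩, ⟨hxt, hat, hbt, hyt, haa'.1, haa'.2, hbb'⟩⟩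
    exact h.false hW hK
  rcases hs.mem_cases hg hxs hx with h1 | h1 | h1
  · exact hnew hr hs hrs hxr hxs hx.adj₁ hx.adj₂ hx.1 hyr har h1.1 h1.2.1
  all_goals rcases ht.mem_cases hg hxt hx with h2 | h2 | h2
  · exact hnew hr ht hrt hxr hxt hx.adj₁ hx.adj₂ hx.1 hyr har h2.1 h2.2.1
  · exact hnew hs ht hst hxs hxt hx.adj₁ hx.adj₃ hx.2.1 h1.1 h1.2.2 h2.1 h2.2.2
  · exact main s t hs ht hrs hrt hst hxs hxt h1 h2
  · exact hnew hr ht hrt hxr hxt hx.adj₁ hx.adj₂ hx.1 hyr har h2.1 h2.2.1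
  · exact main t s ht hs hrt hrs hst.symm hxt hxs h2 h1
  · exact hnew hs ht hst hxs hxt hx.adj₂ hx.adj₃ hx.2.2.1 h1.2.1 h1.2.2 h2.2.1 h2.2.2

end Contradiction

section Transfer

variable {U V W : Type*} {K : SimpleGraph U} {G : SimpleGraph V} {H : SimpleGraph W} {g k : ℕ}

lemma minTwo_map_iff (f : G ↪g H) {s : Finset V} :
    MinTwo H (s.map f.toEmbedding) ↔ MinTwo G s := by
  constructor
  · intro h v hv
    obtain ⟨u, hu, w, hw, huw, h1, h2⟩ := h _ (Finset.mem_map_of_mem _ hv)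
    obtain ⟨u, hu', rfl⟩ := Finset.mem_map.1 hu
    obtain ⟨w, hw', rfl⟩ := Finset.mem_map.1 hw
    exact ⟨u, hu', w, hw', fun h => huw (congrArg _ h), f.map_rel_iff.1 h1, f.map_rel_iff.1 h2⟩
  · intro h v hv
    obtain ⟨v, hv', rfl⟩ := Finset.mem_map.1 hv
    obtain ⟨u, hu, w, hw, huw, h1, h2⟩ := h v hv'
    exact ⟨_, Finset.mem_map_of_mem _ hu, _, Finset.mem_map_of_mem _ hw,
      fun h => huw (f.injective h), f.map_rel_iff.2 h1, f.map_rel_iff.2 h2⟩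

lemma isGCycle_map_iff (f : G ↪g H) {s : Finset V} :
    IsGCycle H g (s.map f.toEmbedding) ↔ IsGCycle G g s := by
  rw [IsGCycle, IsGCycle, minTwo_map_iff, Finset.card_map]

lemma LargeGirth.of_embedding (hH : LargeGirth H g) (f : G ↪g H) : LargeGirth G g := by
  intro s hs h
  simpa using hH (s.map f.toEmbedding) (hs.map) ((minTwo_map_iff f).2 h)

lemma largeGirth_of_egirth (hG : G.egirth = g) : LargeGirth G g := by
  classical
  intro s hs h
  obtain ⟨v, c, hc, hcs⟩ := h.exists_isCycle hs
  have h1 : G.egirth ≤ c.length := egirth_le_length hc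
  rw [hG] at h1
  have h2 : g ≤ c.length := by exact_mod_cast h1
  rw [← hc.card_support_toFinset] at h2
  exact h2.trans (Finset.card_le_card fun w hw => hcs w (List.mem_toFinset.1 hw))

lemma exists_nbrs [Fintype V] [DecidableEq V] [DecidableRel G.Adj]
    (hG : G.IsRegularOfDegree 3) (f : K ≃g G) (v : U) : ∃ a b c, Nbrs K v a b c := by
  obtain ⟨a, b, c, hab, hac, hbc, h⟩ := Finset.card_eq_three.1 (hG (f v))
  refine ⟨f.symm a, f.symm b, f.symm c, by simpa, by simpa, by simpa, fun t => ?_⟩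
  rw [← f.map_adj_iff, ← mem_neighborFinset, h]
  simp [RelIso.eq_symm_apply]

open Classical in
/-- The number of `g`-cycles of `G`, when `G` has girth at least `g`. -/
noncomputable def numGCycles {V : Type*} [Fintype V] (G : SimpleGraph V) (g : ℕ) : ℕ :=
  (Finset.univ.filter (IsGCycle G g)).card

lemma numGCycles_congr [Fintype V] [Fintype W] (f : G ≃g H) : numGCycles G g = numGCycles H g := by
  classical
  refine Finset.card_bij (fun s _ => s.map f.toEmbedding.toEmbedding) ?_ ?_ ?_
  · intro s hs
    simpa using (isGCycle_map_iff f.toEmbedding).2 (by simpa using hs)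
  · intro s _ t _ hst
    exact Finset.map_injective _ hst
  · intro t ht
    have hm : (t.map f.symm.toEmbedding.toEmbedding).map f.toEmbedding.toEmbedding = t := by
      rw [Finset.map_map]
      convert Finset.map_refl using 2
      ext v
      exact f.apply_symm_apply v
    refine ⟨t.map f.symm.toEmbedding.toEmbedding, ?_, hm⟩
    simpa using (isGCycle_map_iff f.symm.toEmbedding).2 (by simpa using ht)

variable [Fintype V] [Fintype W] [DecidableEq V] [DecidableEq W]

lemma SameDeck.symm (h : SameDeck G H k) : SameDeck H G k := by
  obtain ⟨e, he⟩ := h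
  refine ⟨e.symm, fun s => ?_⟩
  obtain ⟨f⟩ := he (e.symm s)
  rw [Equiv.apply_symm_apply] at f
  exact ⟨f.symm⟩

lemma SameDeck.exists_equiv (h : SameDeck G H k) (hcard : Fintype.card V = Fintype.card W)
    {S : Finset V} (hS : S.card = k) :
    ∃ E : V ≃ W, ∀ u ∈ S, ∀ v ∈ S, G.Adj u v ↔ H.Adj (E u) (E v) := by
  obtain ⟨e, he⟩ := h
  obtain ⟨f⟩ := he ⟨S, hS⟩
  have E₀ := Fintype.equivOfCardEq hcard
  let F : V → W := fun u => if h : u ∈ S then (f ⟨u, h⟩).1 else E₀ u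
  have hF : ∀ u (h : u ∈ S), F u = (f ⟨u, h⟩).1 := fun u h => dif_pos h
  obtain ⟨E, hE⟩ := Finset.exists_equiv_extend_of_card_eq (t := Finset.univ) (s := S) (f := F)
    (by simpa) (Finset.subset_univ _) (fun u hu v hv huv => by
      rw [hF u hu, hF v hv] at huv
      simpa using f.injective (Subtype.ext huv))
  refine ⟨E.trans (Equiv.subtypeUnivEquiv (by simp)), fun u hu v hv => ?_⟩
  have h1 : G.Adj u v ↔ H.Adj (f ⟨u, hu⟩).1 (f ⟨v, hv⟩).1 :=
    (f.map_adj_iff (v := ⟨u, hu⟩) (w := ⟨v, hv⟩)).symm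
  rw [h1, ← hF u hu, ← hF v hv, ← hE u hu, ← hE v hv]
  rfl

lemma SameDeck.exists_agreeOff (h : SameDeck G H (Fintype.card V - 2))
    (hcard : Fintype.card V = Fintype.card W) (f : K ≃g G) {x y : U} (hxy : x ≠ y) :
    ∃ K' : SimpleGraph U, Nonempty (K' ≃g H) ∧ AgreeOff K K' x y := by
  obtain ⟨E, hE⟩ := h.exists_equiv hcard (S := {f x, f y}ᶜ) (by
    rw [Finset.card_compl, Finset.card_pair (by simpa)])
  refine ⟨H.comap (f.toEquiv.trans E), ⟨Iso.comap _ _⟩, fun u v hux huy hvx hvy => ?_⟩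
  rw [← f.map_adj_iff, hE _ (by simp [hux, huy]) _ (by simp [hvx, hvy])]
  rfl

lemma SameDeck.largeGirth (h : SameDeck G H k) (hcard : Fintype.card V = Fintype.card W)
    (hG : LargeGirth G g) (hgk : g ≤ k) (hk : k ≤ Fintype.card V) : LargeGirth H g := by
  intro s hs hm
  by_contra! hlt
  obtain ⟨S, hsS, -, hS⟩ := Finset.exists_subsuperset_card_eq (Finset.subset_univ s)
    (hlt.le.trans hgk) (by simpa [← hcard])
  obtain ⟨E, hE⟩ := h.symm.exists_equiv hcard.symm hS
  refine absurd (hG (s.map E.toEmbedding) hs.map ?_) (by simpa using hlt)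
  intro v hv
  obtain ⟨v, hv', rfl⟩ := Finset.mem_map.1 hv
  obtain ⟨u, hu, w, hw, huw, h1, h2⟩ := hm v hv'
  exact ⟨_, Finset.mem_map_of_mem _ hu, _, Finset.mem_map_of_mem _ hw,
    fun h => huw (E.injective h), (hE _ (hsS hv') _ (hsS hu)).1 h1,
    (hE _ (hsS hv') _ (hsS hw)).1 h2⟩

open Classical in
lemma numGCycles_induce (S : Finset V) : numGCycles (G.induce (S : Set V)) g =
    (Finset.univ.filter fun t => IsGCycle G g t ∧ t ⊆ S).card := by
  let f := Embedding.induce (G := G) (S : Set V)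
  refine Finset.card_bij (fun s _ => s.map f.toEmbedding) ?_ ?_ ?_
  · intro s hs
    simp only [Finset.mem_filter, Finset.mem_univ, true_and] at hs ⊢
    refine ⟨(isGCycle_map_iff f).2 hs, fun v hv => ?_⟩
    obtain ⟨v, -, rfl⟩ := Finset.mem_map.1 hv
    exact v.2
  · intro s _ t _ hst
    exact Finset.map_injective _ hst
  · intro t ht
    simp only [Finset.mem_filter, Finset.mem_univ, true_and] at ht
    have hm : (t.subtype (· ∈ (S : Set V))).map f.toEmbedding = t :=
      Finset.subtype_map_of_mem fun v hv => ht.2 hv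
    refine ⟨t.subtype (· ∈ (S : Set V)), ?_, hm⟩
    simp only [Finset.mem_filter, Finset.mem_univ, true_and]
    rw [← isGCycle_map_iff f, hm]
    exact ht.1

lemma sum_numGCycles_induce (hV : 2 ≤ Fintype.card V) :
    ∑ S : {s : Finset V // s.card = Fintype.card V - 2}, numGCycles (G.induce (S.1 : Set V)) g =
      numGCycles G g * (Fintype.card V - g).choose 2 := by
  classical
  have h1 : ∀ S : {s : Finset V // s.card = Fintype.card V - 2},
      numGCycles (G.induce (S.1 : Set V)) g =
        ∑ t ∈ Finset.univ.filter (IsGCycle G g), if t ⊆ S.1 then 1 else 0 := fun S => by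
    rw [numGCycles_induce, ← Finset.filter_filter, Finset.card_filter]
  simp_rw [h1]
  rw [Finset.sum_comm, numGCycles, ← smul_eq_mul]
  refine Finset.sum_const_nat (m := (Fintype.card V - g).choose 2) fun t ht => ?_
  rw [← Finset.card_filter, ← (Finset.mem_filter.1 ht).2.1, ← Finset.card_compl,
    ← Finset.card_powersetCard]
  refine Finset.card_bij (fun S _ => S.1ᶜ) ?_ ?_ ?_
  · rintro ⟨S, hS⟩ hS'
    simp only [Finset.mem_filter, Finset.mem_univ, true_and] at hS'
    rw [Finset.mem_powersetCard, Finset.compl_subset_compl, Finset.card_compl, hS]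
    exact ⟨hS', by omega⟩
  · intro S _ T _ hST
    exact Subtype.ext (compl_injective hST)
  · intro T hT
    rw [Finset.mem_powersetCard] at hT
    refine ⟨⟨Tᶜ, by rw [Finset.card_compl, hT.2]⟩, ?_, compl_compl _⟩
    simp only [Finset.mem_filter, Finset.mem_univ, true_and]
    exact Finset.subset_compl_comm.1 hT.1

lemma SameDeck.numGCycles_eq (h : SameDeck G H (Fintype.card V - 2))
    (hcard : Fintype.card V = Fintype.card W) (hg : g + 2 ≤ Fintype.card V) :
    numGCycles G g = numGCycles H g := by
  obtain ⟨e, he⟩ := h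
  have h1 := sum_numGCycles_induce (G := G) (g := g) (by omega)
  have h2 := sum_numGCycles_induce (G := H) (g := g) (by omega)
  have h3 : ∑ S : {s : Finset V // s.card = Fintype.card V - 2},
      numGCycles (G.induce (S.1 : Set V)) g =
      ∑ S : {s : Finset W // s.card = Fintype.card V - 2},
        numGCycles (H.induce (S.1 : Set W)) g :=
    Fintype.sum_equiv e _ _ fun S => numGCycles_congr (he S).some
  rw [← hcard] at h2
  rw [h1, h2] at h3
  exact Nat.eq_of_mul_eq_mul_right (Nat.choose_pos (by omega)) h3

lemma IsGCycle.add_two_le_card {s : Finset V} (hs : IsGCycle G g s) (hg : 5 ≤ g)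
    (hG : LargeGirth G g) (hn : ∀ v, ∃ a b c, Nbrs G v a b c) : g + 2 ≤ Fintype.card V := by
  have hex : ∀ v ∈ s, ∃ u ∉ s, G.Adj v u := fun v hv => by
    obtain ⟨a, b, c, h⟩ := hn v
    rcases hs.mem_cases hG hv h with h' | h' | h'
    exacts [⟨c, h'.2.2, h.adj₃⟩, ⟨b, h'.2.1, h.adj₂⟩, ⟨a, h'.1, h.adj₁⟩]
  obtain ⟨u, hu, v, hv, huv⟩ := Finset.one_lt_card.1 (show 1 < s.card by rw [hs.1]; omega)
  obtain ⟨u', hu', hau⟩ := hex u hu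
  obtain ⟨v', hv', hav⟩ := hex v hv
  have hne : u' ≠ v' := by
    rintro rfl
    exact huv (hs.eq_of_adj hg hG hu' hu hv hau.symm hav.symm)
  have h1 : 1 < sᶜ.card := Finset.one_lt_card.2 ⟨u', by simpa, v', by simpa, hne⟩
  have h2 := s.card_add_card_compl
  rw [hs.1] at h2
  omega

end Transfer

section Edges

variable {V : Type*} [DecidableEq V] {G : SimpleGraph V} {g : ℕ}

lemma SimpleGraph.Walk.IsCycle.isGCycle {v : V} {c : G.Walk v v} (hc : c.IsCycle)
    (hlen : c.length = g) : IsGCycle G g c.support.toFinset :=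
  ⟨hc.card_support_toFinset.trans hlen, hc.minTwo_support⟩

lemma SimpleGraph.Walk.IsCycle.mem_edges_iff (hG : LargeGirth G g) {v : V} {c : G.Walk v v}
    (hc : c.IsCycle) (hlen : c.length = g) {u w : V} :
    s(u, w) ∈ c.edges ↔ u ∈ c.support.toFinset ∧ w ∈ c.support.toFinset ∧ G.Adj u w := by
  simp only [List.mem_toFinset]
  refine ⟨fun h => ⟨c.fst_mem_support_of_mem_edges h, c.snd_mem_support_of_mem_edges h,
    c.adj_of_mem_edges h⟩, fun ⟨hu, hw, h⟩ => ?_⟩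
  obtain ⟨p, hp, q, hq, hpq, h1, h2⟩ := hc.exists_two_edges hu
  obtain ⟨a, -, b, -, hab, hn⟩ := (hc.isGCycle hlen).two_neighbors hG (List.mem_toFinset.2 hu)
  have e1 := (hn p (List.mem_toFinset.2 hp)).1 (c.adj_of_mem_edges h1)
  have e2 := (hn q (List.mem_toFinset.2 hq)).1 (c.adj_of_mem_edges h2)
  have e3 := (hn w (List.mem_toFinset.2 hw)).1 h
  grind

lemma SimpleGraph.Walk.IsCycle.support_toFinset_ne (hG : LargeGirth G g) {v v' : V}
    {c : G.Walk v v} {c' : G.Walk v' v'} (hc : c.IsCycle) (hc' : c'.IsCycle)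
    (hlen : c.length = g) (hlen' : c'.length = g)
    (hne : {e | e ∈ c.edges} ≠ {e | e ∈ c'.edges}) :
    c.support.toFinset ≠ c'.support.toFinset := by
  refine fun heq => hne (Set.ext fun e => ?_)
  induction e with
  | h u w =>
    rw [Set.mem_ofPred_eq, Set.mem_ofPred_eq, hc.mem_edges_iff hG hlen, hc'.mem_edges_iff hG hlen',
      heq]

end Edges

section Deck

variable {V W : Type*} [Fintype V] [Fintype W] [DecidableEq V] [DecidableEq W]
  {G : SimpleGraph V} {H : SimpleGraph W} [DecidableRel G.Adj] [DecidableRel H.Adj] {g : ℕ}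

lemma SameDeck.flipClass (hG : G.IsRegularOfDegree 3) (hH : H.IsRegularOfDegree 3)
    (hcard : Fintype.card V = Fintype.card W) (hdeck : SameDeck G H (Fintype.card V - 2))
    (hniso : ¬ Nonempty (G ≃g H)) :
    FlipClass fun K : SimpleGraph V => Nonempty (K ≃g G) ∨ Nonempty (K ≃g H) where
  nbrs := by
    rintro K (⟨⟨f⟩⟩ | ⟨⟨f⟩⟩) v
    exacts [exists_nbrs hG f v, exists_nbrs hH f v]
  iso := by
    rintro K K' (⟨⟨f⟩⟩ | ⟨⟨f⟩⟩) ⟨f'⟩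
    exacts [.inl ⟨f'.symm.trans f⟩, .inr ⟨f'.symm.trans f⟩]
  flip := by
    rintro K (⟨⟨f⟩⟩ | ⟨⟨f⟩⟩) x y hxy
    · obtain ⟨K', ⟨f'⟩, h⟩ := hdeck.exists_agreeOff hcard f hxy
      exact ⟨K', .inr ⟨f'⟩, ⟨fun φ => hniso ⟨(f.symm.trans φ).trans f'⟩⟩, h⟩
    · rw [hcard] at hdeck
      obtain ⟨K', ⟨f'⟩, h⟩ := hdeck.symm.exists_agreeOff hcard.symm f hxy
      exact ⟨K', .inl ⟨f'⟩, ⟨fun φ => hniso ⟨((f.symm.trans φ).trans f').symm⟩⟩, h⟩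

lemma SameDeck.girthClass (hG : G.IsRegularOfDegree 3) (hH : H.IsRegularOfDegree 3)
    (hcard : Fintype.card V = Fintype.card W) (hdeck : SameDeck G H (Fintype.card V - 2))
    (hniso : ¬ Nonempty (G ≃g H)) (hgirth : LargeGirth G g) {s : Finset V}
    (hs : IsGCycle G g s) (hne : s.Nonempty) :
    GirthClass (fun K : SimpleGraph V => Nonempty (K ≃g G) ∨ Nonempty (K ≃g H)) g := by
  have hW := hdeck.flipClass hG hH hcard hniso
  have hg : 5 ≤ g := hs.1 ▸ hW.largeGirth_five (.inl ⟨Iso.refl⟩) s hne hs.2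
  have hle := hs.add_two_le_card hg hgirth (exists_nbrs hG Iso.refl)
  have hgH := hdeck.largeGirth hcard hgirth (by omega) (by omega)
  have hnum := hdeck.numGCycles_eq hcard hle
  have hall : ∀ {K : SimpleGraph V}, Nonempty (K ≃g G) ∨ Nonempty (K ≃g H) →
      numGCycles K g = numGCycles G g := by
    rintro K (⟨⟨f⟩⟩ | ⟨⟨f⟩⟩)
    exacts [numGCycles_congr f, (numGCycles_congr f).trans hnum.symm]
  exact
    { toFlipClass := hW
      largeGirth := by
        rintro K (⟨⟨f⟩⟩ | ⟨⟨f⟩⟩)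
        exacts [hgirth.of_embedding f.toEmbedding, hgH.of_embedding f.toEmbedding]
      card_eq := fun hK hK' => (hall hK).trans (hall hK').symm
      five_le := hg }

end Deck

/-- Standing hypotheses: `G` and `H` are 3-regular graphs on the same number `n` of vertices
with the same `(n-2)`-deck, `H` is not isomorphic to `G`, and `g` is the girth of `G`. -/
theorem no_vertex_in_three_g_cycles
    {V W : Type*} [Fintype V] [Fintype W] [DecidableEq V] [DecidableEq W]
    (G : SimpleGraph V) (H : SimpleGraph W)
    [DecidableRel G.Adj] [DecidableRel H.Adj]
    (hG : G.IsRegularOfDegree 3) (hH : H.IsRegularOfDegree 3)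
    (hcard : Fintype.card V = Fintype.card W)
    (hdeck : SameDeck G H (Fintype.card V - 2))
    (hniso : ¬ Nonempty (G ≃g H))
    (g : ℕ) (hgirth : G.egirth = g)
    :
    ¬ ∃ (x : V) (v₁ v₂ v₃ : V) (C₁ : G.Walk v₁ v₁) (C₂ : G.Walk v₂ v₂) (C₃ : G.Walk v₃ v₃),
      C₁.IsCycle ∧ C₂.IsCycle ∧ C₃.IsCycle ∧
      C₁.length = g ∧ C₂.length = g ∧ C₃.length = g ∧
      x ∈ C₁.support ∧ x ∈ C₂.support ∧ x ∈ C₃.support ∧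
      {e | e ∈ C₁.edges} ≠ {e | e ∈ C₂.edges} ∧
      {e | e ∈ C₁.edges} ≠ {e | e ∈ C₃.edges} ∧
      {e | e ∈ C₂.edges} ≠ {e | e ∈ C₃.edges} := by
  rintro ⟨x, v₁, v₂, v₃, C₁, C₂, C₃, h₁, h₂, h₃, l₁, l₂, l₃, x₁, x₂, x₃, n₁₂, n₁₃, n₂₃⟩
  have hL := largeGirth_of_egirth hgirth
  have hW := hdeck.girthClass hG hH hcard hniso hL (h₁.isGCycle l₁) ⟨x, List.mem_toFinset.2 x₁⟩
  exact hW.not_three (.inl ⟨Iso.refl⟩) (h₁.isGCycle l₁) (h₂.isGCycle l₂) (h₃.isGCycle l₃)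
    (h₁.support_toFinset_ne hL h₂ l₁ l₂ n₁₂) (h₁.support_toFinset_ne hL h₃ l₁ l₃ n₁₃)
    (h₂.support_toFinset_ne hL h₃ l₂ l₃ n₂₃) (List.mem_toFinset.2 x₁) (List.mem_toFinset.2 x₂)
    (List.mem_toFinset.2 x₃)
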